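/- arXiv:2306.15754 — 3 statements merged into one kernel-verified Lean document; each statement's English description precedes it below -/
import Mathlib

section
/- Let n be an even positive integer, let K ∈ C^{k,α}_loc(ℝ^n) with k ≥ 0 an integer and 0 < α < 1, and let u ∈ L^∞_loc(ℝ^n) solve the integral equation u(x) = (2/ω_n) ∫_{ℝ^n} log(|y|/|x−y|) K(y) e^{n u(y)} dy with K e^{nu} ∈ L¹(ℝ^n). Then u ∈ C^{n+k,α}_loc(ℝ^n). In particular, if K is smooth then u is smooth. -/
open MeasureTheory Metric Real

/-- The volume `ω_n` of the unit sphere `Sⁿ ⊂ ℝ^{n+1}`, expressed as `(n+1)` times the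
Lebesgue volume of the unit ball of `ℝ^{n+1}`. -/
noncomputable def sphereVol (n : ℕ) : ℝ :=
  (n + 1) * (volume (ball (0 : EuclideanSpace ℝ (Fin (n + 1))) 1)).toReal

/-- `u ∈ L^∞_loc(ℝⁿ)`: `u` is bounded on every bounded set. -/
def LocBdd {n : ℕ} (w : EuclideanSpace ℝ (Fin n) → ℝ) : Prop :=
  ∀ R : ℝ, ∃ M : ℝ, ∀ x : EuclideanSpace ℝ (Fin n), ‖x‖ ≤ R → |w x| ≤ M

/-- `f ∈ C^{k,α}_loc(ℝⁿ)`: `f` is `C^k` and all its derivatives of order at most `k` are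
locally `α`-Hölder continuous. -/
def CkHolderLoc {n : ℕ} (k : ℕ) (α : NNReal) (f : EuclideanSpace ℝ (Fin n) → ℝ) : Prop :=
  ContDiff ℝ k f ∧
  ∀ i : ℕ, i ≤ k → ∀ x₀ : EuclideanSpace ℝ (Fin n),
    ∃ (C : NNReal) (s : Set (EuclideanSpace ℝ (Fin n))),
      s ∈ nhds x₀ ∧ HolderOnWith C α (iteratedFDeriv ℝ i f) s

set_option linter.unusedSectionVars false

section HolderCalculus

variable {E F G H : Type} [NormedAddCommGroup E] [NormedSpace ℝ E]
  [NormedAddCommGroup F] [NormedSpace ℝ F] [NormedAddCommGroup G] [NormedSpace ℝ G]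
  [NormedAddCommGroup H] [NormedSpace ℝ H] {α : ℝ}

/-- `f` is bounded on every ball. -/
def BddOnBalls (f : E → F) : Prop :=
  ∀ R : ℝ, ∃ M : ℝ, 0 ≤ M ∧ ∀ x, ‖x‖ ≤ R → ‖f x‖ ≤ M

/-- `f` is `α`-Hölder continuous on every ball. -/
def HolderOnBalls (α : ℝ) (f : E → F) : Prop :=
  ∀ R : ℝ, ∃ C : ℝ, 0 ≤ C ∧
    ∀ x y, ‖x‖ ≤ R → ‖y‖ ≤ R → ‖f x - f y‖ ≤ C * ‖x - y‖ ^ α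

/-- `f` is of class `C^k` and its `k`-th derivative is `α`-Hölder continuous on every ball. -/
def CkHolder (k : ℕ) (α : ℝ) (f : E → F) : Prop :=
  ContDiff ℝ k f ∧ HolderOnBalls α (iteratedFDeriv ℝ k f)

theorem continuousAt_of_eventually_norm_sub_le_rpow (hα : 0 < α) {f : E → F} {x : E} {C : ℝ}
    (h : ∀ᶠ y in nhds x, ‖f y - f x‖ ≤ C * ‖y - x‖ ^ α) : ContinuousAt f x := by
  rw [ContinuousAt, tendsto_iff_norm_sub_tendsto_zero]
  have hc : Continuous (fun y : E => C * ‖y - x‖ ^ α) :=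
    continuous_const.mul ((continuous_id.sub continuous_const).norm.rpow_const
      fun _ => Or.inr hα.le)
  refine squeeze_zero' (Filter.Eventually.of_forall fun _ => norm_nonneg _) h ?_
  simpa [Real.zero_rpow hα.ne'] using hc.tendsto x

theorem HolderOnBalls.continuous (hα : 0 < α) {f : E → F} (hf : HolderOnBalls α f) :
    Continuous f := by
  rw [continuous_iff_continuousAt]
  intro x
  obtain ⟨C, -, hC⟩ := hf (‖x‖ + 1)
  refine continuousAt_of_eventually_norm_sub_le_rpow hα (C := C) ?_
  filter_upwards [Metric.ball_mem_nhds x one_pos] with y hy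
  refine hC y x ?_ (by linarith)
  have h1 := norm_sub_norm_le y x
  rw [mem_ball, dist_eq_norm] at hy
  linarith

theorem Continuous.bddOnBalls [FiniteDimensional ℝ E] {f : E → F} (hf : Continuous f) :
    BddOnBalls f := by
  have := FiniteDimensional.proper_real E
  intro R
  obtain ⟨M, hM⟩ := (isCompact_closedBall (0 : E) R).exists_bound_of_continuousOn hf.continuousOn
  exact ⟨max M 0, le_max_right _ _, fun x hx =>
    (hM x (mem_closedBall_zero_iff.2 hx)).trans (le_max_left _ _)⟩

theorem HolderOnBalls.of_locally [FiniteDimensional ℝ E] (hα : 0 < α) {f : E → F}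
    (hf : ∀ x₀, ∃ C : ℝ, 0 ≤ C ∧ ∃ s ∈ nhds x₀, ∀ x ∈ s, ∀ y ∈ s,
      ‖f x - f y‖ ≤ C * ‖x - y‖ ^ α) : HolderOnBalls α f := by
  have := FiniteDimensional.proper_real E
  have hcont : Continuous f := by
    rw [continuous_iff_continuousAt]
    intro x
    obtain ⟨C, -, s, hs, hC⟩ := hf x
    refine continuousAt_of_eventually_norm_sub_le_rpow hα (C := C) ?_
    filter_upwards [hs] with y hy using hC y hy x (mem_of_mem_nhds hs)
  intro R
  have key : ∃ C : ℝ, 0 ≤ C ∧ ∀ p ∈ closedBall (0 : E) R ×ˢ closedBall (0 : E) R,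
      ‖f p.1 - f p.2‖ ≤ C * ‖p.1 - p.2‖ ^ α := by
    refine ((isCompact_closedBall (0 : E) R).prod (isCompact_closedBall (0 : E) R)).induction_on
      (p := fun t => ∃ C : ℝ, 0 ≤ C ∧ ∀ p ∈ t, ‖f p.1 - f p.2‖ ≤ C * ‖p.1 - p.2‖ ^ α)
      ⟨0, le_rfl, by simp⟩ ?_ ?_ ?_
    · rintro s t hst ⟨C, h0, hC⟩
      exact ⟨C, h0, fun p hp => hC p (hst hp)⟩
    · rintro s t ⟨C, h0, hC⟩ ⟨D, h1, hD⟩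
      refine ⟨max C D, le_max_of_le_left h0, ?_⟩
      rintro p (hp | hp)
      · exact (hC p hp).trans (by gcongr; exact le_max_left _ _)
      · exact (hD p hp).trans (by gcongr; exact le_max_right _ _)
    · rintro ⟨a, b⟩ -
      rcases eq_or_ne a b with rfl | hab
      · obtain ⟨C, h0, s, hs, hC⟩ := hf a
        exact ⟨s ×ˢ s, mem_nhdsWithin_of_mem_nhds (prod_mem_nhds hs hs), C, h0,
          fun p hp => hC _ hp.1 _ hp.2⟩
      · have hq : ContinuousAt (fun p : E × E => ‖f p.1 - f p.2‖ / ‖p.1 - p.2‖ ^ α) (a, b) := by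
          refine ContinuousAt.div ?_ ?_ ?_
          · exact ((hcont.comp continuous_fst).sub (hcont.comp continuous_snd)).norm.continuousAt
          · exact ((continuous_fst.sub continuous_snd).norm.rpow_const
              fun _ => Or.inr hα.le).continuousAt
          · exact (Real.rpow_pos_of_pos (norm_pos_iff.2 (sub_ne_zero.2 hab)) _).ne'
        have h1 := hq.eventually (gt_mem_nhds (lt_add_one _))
        have h2 : ∀ᶠ p : E × E in nhds (a, b), p.1 ≠ p.2 :=
          (isOpen_ne_fun continuous_fst continuous_snd).mem_nhds hab
        refine ⟨_, mem_nhdsWithin_of_mem_nhds (h1.and h2),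
          ‖f a - f b‖ / ‖a - b‖ ^ α + 1, by positivity, ?_⟩
        rintro p ⟨hp1, hp2⟩
        exact (div_le_iff₀ (Real.rpow_pos_of_pos (norm_pos_iff.2 (sub_ne_zero.2 hp2)) _)).1 hp1.le
  obtain ⟨C, h0, hC⟩ := key
  exact ⟨C, h0, fun x y hx hy => hC (x, y)
    ⟨mem_closedBall_zero_iff.2 hx, mem_closedBall_zero_iff.2 hy⟩⟩

theorem norm_sub_le_rpow_of_norm_le (h1 : α ≤ 1) {R : ℝ} {x y : E}
    (hx : ‖x‖ ≤ R) (hy : ‖y‖ ≤ R) : ‖x - y‖ ≤ (2 * R) ^ (1 - α) * ‖x - y‖ ^ α := by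
  have hxy : ‖x - y‖ ≤ 2 * R := (norm_sub_le x y).trans (by linarith)
  rcases (norm_nonneg (x - y)).eq_or_lt with h | h
  · rw [← h]
    have : 0 ≤ R := (norm_nonneg x).trans hx
    positivity
  · calc ‖x - y‖ = ‖x - y‖ ^ (1 - α) * ‖x - y‖ ^ α := by
          rw [← Real.rpow_add h]; simp
      _ ≤ _ := by gcongr

theorem ContDiff.holderOnBalls [FiniteDimensional ℝ E] (h1 : α ≤ 1) {f : E → F}
    (hf : ContDiff ℝ 1 f) : HolderOnBalls α f := by
  intro R
  obtain ⟨M, hM0, hM⟩ := (hf.continuous_fderiv one_ne_zero).bddOnBalls R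
  refine ⟨M * (2 * |R|) ^ (1 - α), by positivity, fun x y hx hy => ?_⟩
  have h := (convex_closedBall (0 : E) R).norm_image_sub_le_of_norm_fderiv_le (𝕜 := ℝ) (f := f)
    (fun z _ => (hf.differentiable one_ne_zero).differentiableAt)
    (fun z hz => hM z (mem_closedBall_zero_iff.1 hz))
    (mem_closedBall_zero_iff.2 hy) (mem_closedBall_zero_iff.2 hx)
  refine h.trans ?_
  rw [mul_assoc]
  gcongr
  exact norm_sub_le_rpow_of_norm_le h1 (hx.trans (le_abs_self R)) (hy.trans (le_abs_self R))

theorem HolderOnBalls.add {f g : E → F} (hf : HolderOnBalls α f) (hg : HolderOnBalls α g) :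
    HolderOnBalls α (fun x => f x + g x) := by
  intro R
  obtain ⟨C, hC0, hC⟩ := hf R
  obtain ⟨D, hD0, hD⟩ := hg R
  refine ⟨C + D, by positivity, fun x y hx hy => ?_⟩
  calc ‖f x + g x - (f y + g y)‖ = ‖(f x - f y) + (g x - g y)‖ := by congr 1; abel
    _ ≤ ‖f x - f y‖ + ‖g x - g y‖ := norm_add_le _ _
    _ ≤ C * ‖x - y‖ ^ α + D * ‖x - y‖ ^ α := add_le_add (hC x y hx hy) (hD x y hx hy)
    _ = _ := by ring

theorem HolderOnBalls.clm_comp {f : E → F} (hf : HolderOnBalls α f) (A : F →L[ℝ] G) :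
    HolderOnBalls α (fun x => A (f x)) := by
  intro R
  obtain ⟨C, hC0, hC⟩ := hf R
  refine ⟨‖A‖ * C, by positivity, fun x y hx hy => ?_⟩
  rw [← map_sub, mul_assoc]
  exact (A.le_opNorm _).trans (by gcongr; exact hC x y hx hy)

theorem HolderOnBalls.bilinear [FiniteDimensional ℝ E] (hα : 0 < α) {f : E → F} {g : E → G}
    (hf : HolderOnBalls α f) (hg : HolderOnBalls α g) (B : F →L[ℝ] G →L[ℝ] H) :
    HolderOnBalls α (fun x => B (f x) (g x)) := by
  intro R
  obtain ⟨C, hC0, hC⟩ := hf R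
  obtain ⟨D, hD0, hD⟩ := hg R
  obtain ⟨M, hM0, hM⟩ := (hf.continuous hα).bddOnBalls R
  obtain ⟨N, hN0, hN⟩ := (hg.continuous hα).bddOnBalls R
  refine ⟨‖B‖ * C * N + ‖B‖ * M * D, by positivity, fun x y hx hy => ?_⟩
  calc ‖B (f x) (g x) - B (f y) (g y)‖
      = ‖B (f x - f y) (g x) + B (f y) (g x - g y)‖ := by
        congr 1; simp only [map_sub, sub_apply]; abel
    _ ≤ ‖B‖ * ‖f x - f y‖ * ‖g x‖ + ‖B‖ * ‖f y‖ * ‖g x - g y‖ :=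
        (norm_add_le _ _).trans (add_le_add (B.le_opNorm₂ _ _) (B.le_opNorm₂ _ _))
    _ ≤ ‖B‖ * (C * ‖x - y‖ ^ α) * N + ‖B‖ * M * (D * ‖x - y‖ ^ α) := by
        gcongr
        · exact hC x y hx hy
        · exact hN x hx
        · exact hM y hy
        · exact hD x y hx hy
    _ = _ := by ring

theorem ckHolder_zero_iff (hα : 0 < α) {f : E → F} :
    CkHolder 0 α f ↔ HolderOnBalls α f := by
  have key : HolderOnBalls α (iteratedFDeriv ℝ 0 f) ↔ HolderOnBalls α f := by
    simp only [HolderOnBalls, iteratedFDeriv_zero_eq_comp, Function.comp_apply, ← map_sub,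
      LinearIsometryEquiv.norm_map]
  rw [CkHolder, key, and_iff_right_of_imp]
  exact fun h => contDiff_zero.2 (h.continuous hα)

theorem ckHolder_succ_iff {k : ℕ} {f : E → F} :
    CkHolder (k + 1) α f ↔ Differentiable ℝ f ∧ CkHolder k α (fderiv ℝ f) := by
  have key : HolderOnBalls α (iteratedFDeriv ℝ (k + 1) f) ↔
      HolderOnBalls α (iteratedFDeriv ℝ k (fderiv ℝ f)) := by
    have h (x y : E) : ‖iteratedFDeriv ℝ (k + 1) f x - iteratedFDeriv ℝ (k + 1) f y‖ =
        ‖iteratedFDeriv ℝ k (fderiv ℝ f) x - iteratedFDeriv ℝ k (fderiv ℝ f) y‖ := by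
      rw [iteratedFDeriv_succ_eq_comp_right, iteratedFDeriv_succ_eq_comp_right,
        Function.comp_apply, Function.comp_apply, ← LinearIsometryEquiv.map_sub,
        LinearIsometryEquiv.norm_map]
    simp only [HolderOnBalls, h]
  rw [CkHolder, CkHolder, key, Nat.cast_add, Nat.cast_one, contDiff_succ_iff_fderiv]
  simp [and_assoc]

theorem CkHolder.of_hasFDerivAt {k : ℕ} {f : E → F} {f' : E → E →L[ℝ] F}
    (hf : ∀ x, HasFDerivAt f (f' x) x) (hf' : CkHolder k α f') : CkHolder (k + 1) α f := by
  rw [ckHolder_succ_iff]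
  refine ⟨fun x => (hf x).differentiableAt, ?_⟩
  rwa [show fderiv ℝ f = f' from funext fun x => (hf x).fderiv]

theorem ContDiff.ckHolder [FiniteDimensional ℝ E] (h1 : α ≤ 1) {f : E → F} {k : ℕ}
    (hf : ContDiff ℝ (k + 1 : ℕ) f) : CkHolder k α f := by
  refine ⟨hf.of_le (by exact_mod_cast k.le_succ), ContDiff.holderOnBalls h1 ?_⟩
  exact hf.iteratedFDeriv_right (by norm_cast; omega)

theorem CkHolder.of_le [FiniteDimensional ℝ E] (h1 : α ≤ 1) {f : E → F} {k l : ℕ}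
    (hf : CkHolder l α f) (hkl : k ≤ l) : CkHolder k α f := by
  rcases hkl.eq_or_lt with rfl | h
  · exact hf
  · exact (hf.1.of_le (by exact_mod_cast h)).ckHolder h1

theorem CkHolder.add {k : ℕ} {f g : E → F} (hf : CkHolder k α f) (hg : CkHolder k α g) :
    CkHolder k α (fun x => f x + g x) := by
  refine ⟨hf.1.add hg.1, ?_⟩
  rw [show iteratedFDeriv ℝ k (fun x => f x + g x) =
    fun x => iteratedFDeriv ℝ k f x + iteratedFDeriv ℝ k g x from
      funext fun x => fun_iteratedFDeriv_add_apply hf.1.contDiffAt hg.1.contDiffAt]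
  exact hf.2.add hg.2

theorem CkHolder.const_smul {k : ℕ} {f : E → F} (hf : CkHolder k α f) (c : ℝ) :
    CkHolder k α (fun x => c • f x) := by
  refine ⟨hf.1.const_smul c, ?_⟩
  rw [show iteratedFDeriv ℝ k (fun x => c • f x) = fun x => c • iteratedFDeriv ℝ k f x from
      funext fun x => iteratedFDeriv_const_smul_apply' hf.1.contDiffAt]
  exact hf.2.clm_comp (c • ContinuousLinearMap.id ℝ _)

theorem CkHolder.bilinear [FiniteDimensional ℝ E] (hα : 0 < α) (h1 : α ≤ 1) {k : ℕ} :
    ∀ {F G H : Type} [NormedAddCommGroup F] [NormedSpace ℝ F] [NormedAddCommGroup G]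
      [NormedSpace ℝ G] [NormedAddCommGroup H] [NormedSpace ℝ H] {f : E → F} {g : E → G},
      CkHolder k α f → CkHolder k α g → ∀ B : F →L[ℝ] G →L[ℝ] H,
      CkHolder k α (fun x => B (f x) (g x)) := by
  induction k with
  | zero =>
    intro F G H _ _ _ _ _ _ f g hf hg B
    rw [ckHolder_zero_iff hα] at *
    exact hf.bilinear hα hg B
  | succ k ih =>
    intro F G H _ _ _ _ _ _ f g hf hg B
    have hf0 := hf.of_le h1 k.le_succ
    have hg0 := hg.of_le h1 k.le_succ
    rw [ckHolder_succ_iff] at hf hg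
    exact CkHolder.of_hasFDerivAt
      (fun x => B.hasFDerivAt_of_bilinear (hf.1 x).hasFDerivAt (hg.1 x).hasFDerivAt)
      ((ih hf0 hg.2 (B.precompR E)).add (ih hf.2 hg0 (B.precompL E)))

theorem CkHolder.exp [FiniteDimensional ℝ E] (hα : 0 < α) (h1 : α ≤ 1) {k : ℕ} {u : E → ℝ}
    (hu : CkHolder k α u) : CkHolder k α (fun x => Real.exp (u x)) := by
  induction k with
  | zero =>
    rw [ckHolder_zero_iff hα] at *
    intro R
    obtain ⟨C, hC0, hC⟩ := hu R
    obtain ⟨M, hM0, hM⟩ := (hu.continuous hα).bddOnBalls R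
    obtain ⟨D, hD0, hD⟩ := (Real.contDiff_exp (n := 1)).holderOnBalls le_rfl M
    refine ⟨D * C, by positivity, fun x y hx hy => ?_⟩
    have h := hD (u x) (u y) (hM x hx) (hM y hy)
    rw [Real.rpow_one] at h
    rw [mul_assoc]
    exact h.trans (by gcongr; exact hC x y hx hy)
  | succ k ih =>
    have hu0 := hu.of_le h1 k.le_succ
    rw [ckHolder_succ_iff] at hu
    exact CkHolder.of_hasFDerivAt (fun x => (hu.1 x).hasFDerivAt.exp)
      ((ih hu0).bilinear hα h1 hu.2 (ContinuousLinearMap.lsmul ℝ ℝ))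

end HolderCalculus

section DyadicSeries

theorem exists_tsum_le_rpow {α : ℝ} (hα : 0 < α) (h1 : α < 1) :
    ∃ A : ℝ, 0 ≤ A ∧ ∀ (t : ℝ) (b : ℕ → ℝ), 0 ≤ t → (∀ j, 0 ≤ b j) →
      (∀ j, b j ≤ ((2 : ℝ) ^ (-α)) ^ j) → (∀ j, b j ≤ (2 * (2 : ℝ) ^ (-α)) ^ j * t) →
      ∑' j, b j ≤ A * t ^ α := by
  set ρ : ℝ := (2 : ℝ) ^ (-α) with hρ
  have hρ0 : 0 < ρ := by positivity
  have hρ1 : ρ < 1 := Real.rpow_lt_one_of_one_lt_of_neg one_lt_two (by linarith)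
  have hρ2 : 1 < 2 * ρ := by
    have : 2 * ρ = (2 : ℝ) ^ (1 - α) := by
      rw [hρ, sub_eq_add_neg, Real.rpow_add two_pos, Real.rpow_one]
    rw [this]
    exact Real.one_lt_rpow one_lt_two (by linarith)
  have hρα : ρ * (2 : ℝ) ^ α = 1 := by
    rw [hρ, ← Real.rpow_add two_pos]; simp
  set D : ℝ := (2 * ρ - 1)⁻¹ with hD
  have hD0 : 0 < D := inv_pos.2 (by linarith)
  have hD1 : (2 * ρ - 1) * D = 1 := mul_inv_cancel₀ (by linarith)
  set A : ℝ := (1 - ρ)⁻¹ + 2 * D with hA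
  have hρi : 0 < (1 - ρ)⁻¹ := inv_pos.2 (by linarith)
  have hA0 : 0 < A := by positivity
  have hgeo : Summable fun j : ℕ => ρ ^ j := summable_geometric_of_lt_one hρ0.le hρ1
  have hsum {b : ℕ → ℝ} (hb : ∀ j, 0 ≤ b j) (hb' : ∀ j, b j ≤ ρ ^ j) : Summable b :=
    .of_nonneg_of_le hb hb' hgeo
  have hle {b : ℕ → ℝ} (hb : ∀ j, 0 ≤ b j) (hb' : ∀ j, b j ≤ ρ ^ j) :
      ∑' j, b j ≤ (1 - ρ)⁻¹ := by
    rw [← tsum_geometric_of_lt_one hρ0.le hρ1]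
    exact (hsum hb hb').tsum_le_tsum hb' hgeo
  have main : ∀ (N : ℕ) (t : ℝ) (b : ℕ → ℝ), 1 ≤ 2 ^ N * t → t ≤ 2 → (∀ j, 0 ≤ b j) →
      (∀ j, b j ≤ ρ ^ j) → (∀ j, b j ≤ (2 * ρ) ^ j * t) → ∑' j, b j ≤ A * t ^ α - D * t := by
    have base (t : ℝ) (b : ℕ → ℝ) (ht : 1 ≤ t) (ht2 : t ≤ 2) (hb : ∀ j, 0 ≤ b j)
        (hb' : ∀ j, b j ≤ ρ ^ j) : ∑' j, b j ≤ A * t ^ α - D * t := by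
      have h2 : 1 ≤ t ^ α := Real.one_le_rpow ht hα.le
      have h3 := hle hb hb'
      nlinarith
    intro N
    induction N with
    | zero =>
      intro t b ht ht2 hb hb' _
      exact base t b (by simpa using ht) ht2 hb hb'
    | succ N ih =>
      intro t b ht ht2 hb hb1 hb2
      rcases le_total 1 t with h | h
      · exact base t b h ht2 hb hb1
      have ht0 : 0 < t := by
        by_contra hneg
        have : (2 : ℝ) ^ (N + 1) * t ≤ 0 :=
          mul_nonpos_of_nonneg_of_nonpos (by positivity) (not_lt.1 hneg)
        linarith
      have h4 := ih (2 * t) (fun j => ρ⁻¹ * b (j + 1)) (by rw [pow_succ] at ht; linarith)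
        (by linarith) (fun j => by have := hb (j + 1); positivity)
        (fun j => by
          rw [inv_mul_le_iff₀ hρ0, ← pow_succ']; exact hb1 _)
        (fun j => by
          rw [inv_mul_le_iff₀ hρ0]
          refine (hb2 (j + 1)).trans_eq ?_
          ring)
      rw [tsum_mul_left, inv_mul_le_iff₀ hρ0, Real.mul_rpow two_pos.le ht0.le] at h4
      rw [(hsum hb hb1).tsum_eq_zero_add]
      have h5 : b 0 ≤ t := by simpa using hb2 0
      have h6 : ρ * (A * (2 ^ α * t ^ α) - D * (2 * t)) = A * t ^ α - D * t - t := by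
        linear_combination (A * t ^ α) * hρα - t * hD1
      linarith
  refine ⟨A, hA0.le, fun t b ht hb hb1 hb2 => ?_⟩
  rcases le_total 1 t with h | h
  · have h2 : 1 ≤ t ^ α := Real.one_le_rpow h hα.le
    have h3 := hle hb hb1
    nlinarith
  rcases ht.eq_or_lt with rfl | ht0
  · have : ∀ j, b j = 0 := fun j => le_antisymm (by simpa using hb2 j) (hb j)
    simp only [this, tsum_zero]
    positivity
  · obtain ⟨N, hN⟩ := pow_unbounded_of_one_lt t⁻¹ one_lt_two
    have h1N : 1 ≤ 2 ^ N * t := by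
      have := mul_lt_mul_of_pos_right hN ht0
      rw [inv_mul_cancel₀ ht0.ne'] at this
      exact this.le
    have := main N t b h1N (by linarith) hb hb1 hb2
    nlinarith

variable {E F : Type} [NormedAddCommGroup E] [NormedSpace ℝ E]
  [NormedAddCommGroup F] [NormedSpace ℝ F] [CompleteSpace F]

theorem holderOnBalls_tsum {α : ℝ} (hα : 0 < α) (h1 : α < 1) {W : ℕ → E → F}
    {W' : ℕ → E → E →L[ℝ] F} (hW : ∀ j x, HasFDerivAt (W j) (W' j x) x)
    (hb : ∀ R : ℝ, ∃ C : ℝ, 0 ≤ C ∧ ∀ j x, ‖x‖ ≤ R → ‖W j x‖ ≤ C * ((2 : ℝ) ^ (-α)) ^ j)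
    (hb' : ∀ R : ℝ, ∃ C : ℝ, 0 ≤ C ∧
      ∀ j x, ‖x‖ ≤ R → ‖W' j x‖ ≤ C * (2 * (2 : ℝ) ^ (-α)) ^ j) :
    HolderOnBalls α (fun x => ∑' j, W j x) := by
  intro R
  obtain ⟨A, hA0, hA⟩ := exists_tsum_le_rpow hα h1
  obtain ⟨C, hC0, hC⟩ := hb R
  obtain ⟨C', hC0', hC'⟩ := hb' R
  set D : ℝ := 2 * C + C' + 1 with hD
  have hD0 : 0 < D := by positivity
  have hgeo : Summable fun j : ℕ => ((2 : ℝ) ^ (-α)) ^ j :=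
    summable_geometric_of_lt_one (by positivity)
      (Real.rpow_lt_one_of_one_lt_of_neg one_lt_two (by linarith))
  have hs {x : E} (hx : ‖x‖ ≤ R) : Summable fun j => W j x :=
    .of_norm_bounded (hgeo.mul_left C) fun j => hC j x hx
  refine ⟨D * A, by positivity, fun x y hx hy => ?_⟩
  have hd1 (j : ℕ) : ‖W j x - W j y‖ ≤ D * ((2 : ℝ) ^ (-α)) ^ j := by
    refine (norm_sub_le _ _).trans ((add_le_add (hC j x hx) (hC j y hy)).trans ?_)
    rw [← add_mul]
    gcongr
    linarith
  have hd2 (j : ℕ) : ‖W j x - W j y‖ ≤ D * ((2 * (2 : ℝ) ^ (-α)) ^ j * ‖x - y‖) := by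
    have h := (convex_closedBall (0 : E) R).norm_image_sub_le_of_norm_hasFDerivWithin_le
      (fun z _ => (hW j z).hasFDerivWithinAt)
      (fun z hz => hC' j z (mem_closedBall_zero_iff.1 hz))
      (mem_closedBall_zero_iff.2 hy) (mem_closedBall_zero_iff.2 hx)
    refine h.trans ?_
    rw [← mul_assoc]
    gcongr
    linarith
  have hsn : Summable fun j => ‖W j x - W j y‖ :=
    .of_nonneg_of_le (fun _ => norm_nonneg _) hd1 (hgeo.mul_left D)
  rw [← (hs hx).tsum_sub (hs hy)]
  refine (norm_tsum_le_tsum_norm hsn).trans ?_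
  have h := hA ‖x - y‖ (fun j => D⁻¹ * ‖W j x - W j y‖) (norm_nonneg _)
    (fun j => by positivity) (fun j => by rw [inv_mul_le_iff₀ hD0]; exact hd1 j)
    (fun j => by rw [inv_mul_le_iff₀ hD0]; exact hd2 j)
  rw [tsum_mul_left, inv_mul_le_iff₀ hD0] at h
  rwa [mul_assoc]

theorem hasFDerivAt_tsum_of_geometric_bound {ρ : ℝ} (hρ0 : 0 ≤ ρ) (hρ1 : ρ < 1) {W : ℕ → E → F}
    {W' : ℕ → E → E →L[ℝ] F} (hW : ∀ j x, HasFDerivAt (W j) (W' j x) x)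
    (hs : ∀ x, Summable fun j => W j x)
    (hb : ∀ R : ℝ, ∃ C : ℝ, 0 ≤ C ∧ ∀ j x, ‖x‖ ≤ R → ‖W' j x‖ ≤ C * ρ ^ j) (x : E) :
    HasFDerivAt (fun x => ∑' j, W j x) (∑' j, W' j x) x := by
  obtain ⟨C, -, hC⟩ := hb (‖x‖ + 1)
  have hx : x ∈ ball (0 : E) (‖x‖ + 1) := by simp
  exact hasFDerivAt_tsum_of_isPreconnected
    ((summable_geometric_of_lt_one hρ0 hρ1).mul_left C) isOpen_ball
    (convex_ball (0 : E) _).isPreconnected (fun j y _ => hW j y)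
    (fun j y hy => hC j y (mem_ball_zero_iff.1 hy).le) hx (hs x) hx

end DyadicSeries

section DyadicConvolution

open Module (finrank)

variable {E F G H : Type} [NormedAddCommGroup E] [NormedSpace ℝ E] [FiniteDimensional ℝ E]
  [MeasurableSpace E] [BorelSpace E] {μ : Measure E} [μ.IsAddHaarMeasure]
  [NormedAddCommGroup F] [NormedSpace ℝ F] [NormedAddCommGroup G] [NormedSpace ℝ G]
  [NormedAddCommGroup H] [NormedSpace ℝ H]

/-- Smooth functions supported in the closed unit ball. -/
structure IsUnitBump (φ : E → G) : Prop where
  contDiff : ContDiff ℝ (⊤ : ℕ∞) φ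
  tsupport_subset : tsupport φ ⊆ closedBall 0 1

theorem IsUnitBump.fderiv {φ : E → G} (hφ : IsUnitBump φ) : IsUnitBump (fderiv ℝ φ) :=
  ⟨hφ.contDiff.fderiv_right (by simp), (tsupport_fderiv_subset ℝ).trans hφ.tsupport_subset⟩

theorem IsUnitBump.hasCompactSupport {φ : E → G} (hφ : IsUnitBump φ) : HasCompactSupport φ := by
  have := FiniteDimensional.proper_real E
  exact (isCompact_closedBall (0 : E) 1).of_isClosed_subset (isClosed_tsupport φ)
    hφ.tsupport_subset

theorem IsUnitBump.eq_zero {φ : E → G} (hφ : IsUnitBump φ) {z : E} (hz : 1 < ‖z‖) : φ z = 0 := by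
  refine image_eq_zero_of_notMem_tsupport fun h => ?_
  have := mem_closedBall_zero_iff.1 (hφ.tsupport_subset h)
  linarith

/-- The dilation by `2 ^ j` of a function. -/
def dyadicDilate (φ : E → G) (j : ℕ) (z : E) : G := φ ((2 : ℝ) ^ j • z)

theorem IsUnitBump.contDiff_dilate {φ : E → G} (hφ : IsUnitBump φ) (j : ℕ) :
    ContDiff ℝ (⊤ : ℕ∞) (dyadicDilate φ j) :=
  hφ.contDiff.comp (contDiff_const_smul _)

theorem IsUnitBump.hasCompactSupport_dilate {φ : E → G} (hφ : IsUnitBump φ) (j : ℕ) :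
    HasCompactSupport (dyadicDilate φ j) :=
  hφ.hasCompactSupport.comp_smul (by positivity)

theorem IsUnitBump.fderiv_dilate {φ : E → G} (hφ : IsUnitBump φ) (j : ℕ) (z : E) :
    _root_.fderiv ℝ (dyadicDilate φ j) z =
      (2 : ℝ) ^ j • dyadicDilate (_root_.fderiv ℝ φ) j z := by
  have h1 : HasFDerivAt φ (_root_.fderiv ℝ φ ((2 : ℝ) ^ j • z)) ((2 : ℝ) ^ j • z) :=
    ((hφ.contDiff.differentiable (by simp)) _).hasFDerivAt
  have h2 : HasFDerivAt (fun z : E => (2 : ℝ) ^ j • z)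
      ((2 : ℝ) ^ j • ContinuousLinearMap.id ℝ E) z := (hasFDerivAt_id z).const_smul _
  have h3 := (h1.comp z h2).fderiv
  rw [show dyadicDilate φ j = φ ∘ fun z => (2 : ℝ) ^ j • z from rfl, h3]
  ext v
  simp [dyadicDilate]

/-- The convolution of `f` with the dilation by `2 ^ j` of `φ`. -/
noncomputable def dyadicConv (μ : Measure E) (L : F →L[ℝ] G →L[ℝ] H) (f : E → F) (φ : E → G)
    (j : ℕ) (x : E) : H :=
  ∫ y, L (f y) (dyadicDilate φ j (x - y)) ∂μ

theorem integral_dilate [CompleteSpace G] (φ : E → G) (j : ℕ) (x : E) :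
    ∫ y, dyadicDilate φ j (x - y) ∂μ = (((2 : ℝ) ^ j) ^ finrank ℝ E)⁻¹ • ∫ z, φ z ∂μ := by
  rw [integral_sub_left_eq_self (dyadicDilate φ j) μ x]
  simp only [dyadicDilate]
  rw [Measure.integral_comp_smul, abs_of_nonneg (by positivity)]

theorem integrable_bilinear_dilate {L : F →L[ℝ] G →L[ℝ] H} {f : E → F} {φ : E → G}
    (hf : LocallyIntegrable f μ) (hφ : IsUnitBump φ) (j : ℕ) (x : E) :
    Integrable (fun y => L (f y) (dyadicDilate φ j (x - y))) μ :=
  (hφ.hasCompactSupport_dilate j).convolutionExists_right L hf (hφ.contDiff_dilate j).continuous x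

theorem norm_bilinear_dilate_le {L : F →L[ℝ] G →L[ℝ] H} {f : E → F} {φ : E → G}
    (hφ : IsUnitBump φ) {j : ℕ} {x : E} {M : ℝ}
    (hM : ∀ y, ‖x - y‖ ≤ ((2 : ℝ) ^ j)⁻¹ → ‖f y‖ ≤ M) (y : E) :
    ‖L (f y) (dyadicDilate φ j (x - y))‖ ≤
      ‖L‖ * M * dyadicDilate (fun z => ‖φ z‖) j (x - y) := by
  rcases le_or_gt ‖x - y‖ (((2 : ℝ) ^ j)⁻¹) with h | h
  · refine (L.le_opNorm₂ _ _).trans ?_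
    have := hM y h
    simp only [dyadicDilate]
    gcongr
  · have : φ ((2 : ℝ) ^ j • (x - y)) = 0 := by
      apply hφ.eq_zero
      rw [norm_smul, norm_pow, Real.norm_ofNat]
      rwa [inv_lt_iff_one_lt_mul₀' (by positivity)] at h
    simp [dyadicDilate, this]

theorem integrable_norm_dilate {φ : E → G} (hφ : IsUnitBump φ) (j : ℕ) (x : E) :
    Integrable (fun y => dyadicDilate (fun z => ‖φ z‖) j (x - y)) μ :=
  (((hφ.contDiff_dilate j).continuous.integrable_of_hasCompactSupport
    (hφ.hasCompactSupport_dilate j)).comp_sub_left x).norm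

theorem integral_norm_bilinear_dilate_le {L : F →L[ℝ] G →L[ℝ] H} {f : E → F} {φ : E → G}
    (hφ : IsUnitBump φ) {j : ℕ} {x : E} {M : ℝ}
    (hM : ∀ y, ‖x - y‖ ≤ ((2 : ℝ) ^ j)⁻¹ → ‖f y‖ ≤ M) :
    ∫ y, ‖L (f y) (dyadicDilate φ j (x - y))‖ ∂μ ≤
      ‖L‖ * M * (((2 : ℝ) ^ j) ^ finrank ℝ E)⁻¹ * ∫ z, ‖φ z‖ ∂μ := by
  refine (integral_mono_of_nonneg (Filter.Eventually.of_forall fun _ => norm_nonneg _)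
    ((integrable_norm_dilate hφ j x).const_mul (‖L‖ * M))
    (Filter.Eventually.of_forall fun y => norm_bilinear_dilate_le hφ hM y)).trans_eq ?_
  rw [integral_const_mul, integral_dilate, smul_eq_mul, mul_assoc _ _ (∫ z, ‖φ z‖ ∂μ)]

theorem norm_dyadicConv_le {L : F →L[ℝ] G →L[ℝ] H} {f : E → F} {φ : E → G}
    (hφ : IsUnitBump φ) {j : ℕ} {x : E} {M : ℝ}
    (hM : ∀ y, ‖x - y‖ ≤ ((2 : ℝ) ^ j)⁻¹ → ‖f y‖ ≤ M) :
    ‖dyadicConv μ L f φ j x‖ ≤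
      ‖L‖ * M * (((2 : ℝ) ^ j) ^ finrank ℝ E)⁻¹ * ∫ z, ‖φ z‖ ∂μ :=
  (norm_integral_le_integral_norm _).trans (integral_norm_bilinear_dilate_le hφ hM)

theorem exists_norm_dyadicConv_le {L : F →L[ℝ] G →L[ℝ] H} {f : E → F} {φ : E → G}
    (hf : BddOnBalls f) (hφ : IsUnitBump φ) (R : ℝ) :
    ∃ C : ℝ, 0 ≤ C ∧ ∀ j x, ‖x‖ ≤ R →
      ‖dyadicConv μ L f φ j x‖ ≤ C * (((2 : ℝ) ^ j) ^ finrank ℝ E)⁻¹ := by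
  obtain ⟨M, hM0, hM⟩ := hf (R + 1)
  refine ⟨‖L‖ * M * ∫ z, ‖φ z‖ ∂μ, by positivity, fun j x hx => ?_⟩
  refine (norm_dyadicConv_le (M := M) hφ fun y hy => hM y ?_).trans_eq (by ring)
  have h1 : ((2 : ℝ) ^ j)⁻¹ ≤ 1 := inv_le_one_of_one_le₀ (one_le_pow₀ one_le_two)
  have h2 := norm_sub_norm_le y x
  rw [norm_sub_rev] at h2
  linarith

theorem integral_fderiv_eq_zero [CompleteSpace G] {φ : E → G} (hφ : IsUnitBump φ) :
    ∫ z, fderiv ℝ φ z ∂μ = 0 := by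
  have h := hφ.hasCompactSupport.hasFDerivAt_convolution_right (μ := μ)
    (ContinuousLinearMap.lsmul ℝ ℝ) (f := fun _ : E => (1 : ℝ))
    (locallyIntegrable_const 1) (hφ.contDiff.of_le (by simp)) 0
  have h2 : (convolution (fun _ : E => (1 : ℝ)) φ (ContinuousLinearMap.lsmul ℝ ℝ) μ) =
      fun _ => ∫ z, φ z ∂μ := by
    ext x
    simp [convolution_def, integral_sub_left_eq_self φ μ x]
  rw [h2] at h
  have h3 := h.unique (hasFDerivAt_const _ _)
  rw [convolution_def] at h3
  rw [← h3, ← integral_sub_left_eq_self (fderiv ℝ φ) μ 0]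
  congr 1
  ext y v
  simp [ContinuousLinearMap.precompR_apply]

theorem exists_norm_dyadicConv_le_of_integral_eq_zero [CompleteSpace G] [CompleteSpace H]
    {L : F →L[ℝ] G →L[ℝ] H}
    {f : E → F} {φ : E → G} {α : ℝ} (hα : 0 < α) (hf : HolderOnBalls α f) (hφ : IsUnitBump φ)
    (h0 : ∫ z, φ z ∂μ = 0) (R : ℝ) :
    ∃ C : ℝ, 0 ≤ C ∧ ∀ j x, ‖x‖ ≤ R → ‖dyadicConv μ L f φ j x‖ ≤
      C * ((2 : ℝ) ^ (-α)) ^ j * (((2 : ℝ) ^ j) ^ finrank ℝ E)⁻¹ := by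
  obtain ⟨C, hC0, hC⟩ := hf (R + 1)
  refine ⟨‖L‖ * C * ∫ z, ‖φ z‖ ∂μ, by positivity, fun j x hx => ?_⟩
  have hcont := hf.continuous hα
  have h1 : ((2 : ℝ) ^ j)⁻¹ ≤ 1 := inv_le_one_of_one_le₀ (one_le_pow₀ one_le_two)
  have heq : dyadicConv μ L f φ j x = dyadicConv μ L (fun y => f y - f x) φ j x := by
    have hc : ∫ y, L (f x) (dyadicDilate φ j (x - y)) ∂μ = 0 := by
      rw [ContinuousLinearMap.integral_comp_comm _
        (((hφ.contDiff_dilate j).continuous.integrable_of_hasCompactSupport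
          (hφ.hasCompactSupport_dilate j)).comp_sub_left x), integral_dilate, h0]
      simp
    have hs := integral_sub (integrable_bilinear_dilate (L := L) (μ := μ)
        hcont.locallyIntegrable hφ j x)
      (integrable_bilinear_dilate (L := L) (μ := μ) (locallyIntegrable_const (f x)) hφ j x)
    rw [hc, sub_zero] at hs
    simp only [dyadicConv, map_sub, sub_apply]
    exact hs.symm
  rw [heq]
  refine (norm_dyadicConv_le (M := C * ((2 : ℝ) ^ (-α)) ^ j) hφ fun y hy => ?_).trans_eq
    (by ring)
  have h2 := norm_sub_norm_le y x
  rw [norm_sub_rev] at h2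
  refine (hC y x (by linarith) (by linarith)).trans ?_
  have h3 : ((2 : ℝ) ^ (-α)) ^ j = (((2 : ℝ) ^ j)⁻¹) ^ α := by
    rw [Real.inv_rpow (by positivity), ← Real.rpow_natCast, ← Real.rpow_mul two_pos.le,
      ← Real.rpow_natCast, ← Real.rpow_mul two_pos.le, ← Real.rpow_neg two_pos.le]
    congr 1; ring
  rw [h3, norm_sub_rev]
  gcongr

theorem hasFDerivAt_dyadicConv {L : F →L[ℝ] G →L[ℝ] H} {f : E → F} {φ : E → G}
    (hf : LocallyIntegrable f μ) (hφ : IsUnitBump φ) (j : ℕ) (x : E) :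
    HasFDerivAt (dyadicConv μ L f φ j)
      ((2 : ℝ) ^ j • dyadicConv μ (L.precompR E) f (fderiv ℝ φ) j x) x := by
  have h := (hφ.hasCompactSupport_dilate j).hasFDerivAt_convolution_right L hf
    ((hφ.contDiff_dilate j).of_le (by simp)) x
  convert! h using 1
  rw [convolution_def, dyadicConv, ← integral_smul]
  congr 1
  ext1 y
  rw [hφ.fderiv_dilate, map_smul]

theorem hasFDerivAt_dyadicConv_left {L : F →L[ℝ] G →L[ℝ] H} {f : E → F} {φ : E → G}
    (hf : ContDiff ℝ 1 f) (hφ : IsUnitBump φ) (j : ℕ) (x : E) :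
    HasFDerivAt (dyadicConv μ L f φ j) (dyadicConv μ (L.precompL E) (fderiv ℝ f) φ j x) x := by
  have hswap {F' G' H' : Type} [NormedAddCommGroup F'] [NormedSpace ℝ F'] [NormedAddCommGroup G']
      [NormedSpace ℝ G'] [NormedAddCommGroup H'] [NormedSpace ℝ H']
      (B : F' →L[ℝ] G' →L[ℝ] H') (f : E → F') (φ : E → G') (x : E) :
      dyadicConv μ B f φ j x = ∫ y, B (f (x - y)) (dyadicDilate φ j y) ∂μ := by
    rw [dyadicConv, ← integral_sub_left_eq_self _ μ x]
    simp
  have hfun : dyadicConv μ L f φ j = fun x => ∫ y, L (f (x - y)) (dyadicDilate φ j y) ∂μ :=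
    funext fun x => hswap L f φ x
  rw [hfun, hswap]
  obtain ⟨M, hM0, hM⟩ := (hf.continuous_fderiv one_ne_zero).bddOnBalls (‖x‖ + 2)
  have hbound {F' G' H' : Type} [NormedAddCommGroup F'] [NormedSpace ℝ F'] [NormedAddCommGroup G']
      [NormedSpace ℝ G'] [NormedAddCommGroup H'] [NormedSpace ℝ H'] (B : F' →L[ℝ] G' →L[ℝ] H') :
      ∃ c : ℝ, 0 ≤ c ∧ ∀ v w, ‖B v w‖ ≤ c * ‖v‖ * ‖w‖ :=
    ⟨‖B‖, B.opNorm_nonneg, B.le_opNorm₂⟩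
  obtain ⟨c, hc0, hcB⟩ := hbound (L.precompL E)
  have hint : Integrable (dyadicDilate φ j) μ :=
    (hφ.contDiff_dilate j).continuous.integrable_of_hasCompactSupport
      (hφ.hasCompactSupport_dilate j)
  have hc := (hφ.contDiff_dilate j).continuous
  refine hasFDerivAt_integral_of_dominated_of_fderiv_le
    (F' := fun x y => L.precompL E (fderiv ℝ f (x - y)) (dyadicDilate φ j y))
    (bound := fun y => c * M * ‖dyadicDilate φ j y‖)
    (Metric.ball_mem_nhds x one_pos) ?_ ?_ ?_ ?_ ?_ ?_
  · refine Filter.Eventually.of_forall fun z => Continuous.aestronglyMeasurable ?_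
    exact L.continuous₂.comp₂ (hf.continuous.comp (continuous_const.sub continuous_id)) hc
  · refine Continuous.integrable_of_hasCompactSupport
      (L.continuous₂.comp₂ (hf.continuous.comp (continuous_const.sub continuous_id)) hc) ?_
    exact (hφ.hasCompactSupport_dilate j).mono fun y hy h0 => hy (by simp [h0])
  · exact ((L.precompL E).continuous₂.comp₂
      ((hf.continuous_fderiv one_ne_zero).comp (continuous_const.sub continuous_id))
      hc).aestronglyMeasurable
  · refine Filter.Eventually.of_forall fun y z hz => ?_
    by_cases hy : dyadicDilate φ j y = 0
    · simp [hy]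
    refine (hcB _ _).trans ?_
    gcongr
    apply hM
    have h1 : ‖y‖ ≤ 1 := by
      by_contra hlt
      refine hy (hφ.eq_zero ?_)
      rw [norm_smul, norm_pow, Real.norm_ofNat]
      have : (1 : ℝ) ≤ 2 ^ j := one_le_pow₀ one_le_two
      nlinarith [not_le.1 hlt]
    have h2 := norm_sub_norm_le z x
    rw [mem_ball, dist_eq_norm] at hz
    have h3 := norm_sub_le z y
    linarith
  · exact hint.norm.const_mul _
  · refine Filter.Eventually.of_forall fun y z _ => ?_
    have h1 : HasFDerivAt (fun z => f (z - y)) (fderiv ℝ f (z - y)) z := by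
      have := ((hf.differentiable one_ne_zero) (z - y)).hasFDerivAt.comp z
        ((hasFDerivAt_id z).sub_const y)
      simpa [Function.comp_def] using this
    have h2 := L.hasFDerivAt_of_bilinear h1 (hasFDerivAt_const (dyadicDilate φ j y) z)
    simpa using h2

end DyadicConvolution

section DyadicSum

open Module (finrank)

variable {E F G H : Type} [NormedAddCommGroup E] [NormedSpace ℝ E] [FiniteDimensional ℝ E]
  [MeasurableSpace E] [BorelSpace E] {μ : Measure E} [μ.IsAddHaarMeasure]
  [NormedAddCommGroup F] [NormedSpace ℝ F] [NormedAddCommGroup G] [NormedSpace ℝ G]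
  [NormedAddCommGroup H] [NormedSpace ℝ H] {α : ℝ}

/-- The convolution of `f` with the kernel `z ↦ ∑ j, 2 ^ (j * s) • φ (2 ^ j • z)`. -/
noncomputable def dyadicSum (μ : Measure E) (L : F →L[ℝ] G →L[ℝ] H) (f : E → F) (φ : E → G)
    (s : ℕ) (x : E) : H :=
  ∑' j : ℕ, ((2 : ℝ) ^ j) ^ s • dyadicConv μ L f φ j x

theorem pow_mul_inv_pow_le_half_pow {s N : ℕ} (h : s < N) (j : ℕ) :
    ((2 : ℝ) ^ j) ^ s * (((2 : ℝ) ^ j) ^ N)⁻¹ ≤ (1 / 2) ^ j := by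
  have h1 : (1 : ℝ) ≤ 2 ^ j := one_le_pow₀ one_le_two
  rw [one_div, inv_pow, mul_inv_le_iff₀ (by positivity), ← div_eq_inv_mul,
    le_div_iff₀ (by positivity), ← pow_succ]
  exact pow_le_pow_right₀ h1 h

theorem half_le_two_rpow_neg (h1 : α ≤ 1) : (1 / 2 : ℝ) ≤ (2 : ℝ) ^ (-α) := by
  rw [one_div, ← Real.rpow_neg_one]
  exact Real.rpow_le_rpow_of_exponent_le one_le_two (by linarith)

theorem summable_smul_dyadicConv [CompleteSpace H] {L : F →L[ℝ] G →L[ℝ] H} {f : E → F}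
    {φ : E → G} (hf : BddOnBalls f) (hφ : IsUnitBump φ) {s : ℕ} (hs : s < finrank ℝ E) (x : E) :
    Summable fun j : ℕ => ((2 : ℝ) ^ j) ^ s • dyadicConv μ L f φ j x := by
  obtain ⟨C, hC0, hC⟩ := exists_norm_dyadicConv_le (μ := μ) (L := L) hf hφ ‖x‖
  refine .of_norm_bounded ((summable_geometric_of_lt_one (r := (1 / 2 : ℝ)) (by norm_num)
    (by norm_num)).mul_left C) fun j => ?_
  rw [norm_smul, Real.norm_of_nonneg (by positivity)]
  calc ((2 : ℝ) ^ j) ^ s * ‖dyadicConv μ L f φ j x‖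
      ≤ ((2 : ℝ) ^ j) ^ s * (C * (((2 : ℝ) ^ j) ^ finrank ℝ E)⁻¹) := by
        gcongr; exact hC j x le_rfl
    _ = C * (((2 : ℝ) ^ j) ^ s * (((2 : ℝ) ^ j) ^ finrank ℝ E)⁻¹) := by ring
    _ ≤ _ := by gcongr; exact pow_mul_inv_pow_le_half_pow hs j

theorem holderOnBalls_dyadicSum_of_bddOnBalls [CompleteSpace H] (hα : 0 < α) (h1 : α < 1)
    (hE : 0 < finrank ℝ E)
    {L : F →L[ℝ] G →L[ℝ] H} {f : E → F} {φ : E → G} (hfi : LocallyIntegrable f μ)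
    (hf : BddOnBalls f) (hφ : IsUnitBump φ) : HolderOnBalls α (dyadicSum μ L f φ 0) := by
  have hρ := half_le_two_rpow_neg h1.le
  have hhalf := pow_mul_inv_pow_le_half_pow hE
  simp only [pow_zero, one_mul] at hhalf
  unfold dyadicSum
  simp only [pow_zero, one_smul]
  refine holderOnBalls_tsum hα h1 (fun j x => hasFDerivAt_dyadicConv hfi hφ j x)
    (fun R => ?_) fun R => ?_
  · obtain ⟨C, hC0, hC⟩ := exists_norm_dyadicConv_le (μ := μ) (L := L) hf hφ R
    refine ⟨C, hC0, fun j x hx => (hC j x hx).trans ?_⟩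
    gcongr
    exact (hhalf j).trans (by gcongr)
  · obtain ⟨C, hC0, hC⟩ := exists_norm_dyadicConv_le (μ := μ) (L := L.precompR E) hf hφ.fderiv R
    refine ⟨C, hC0, fun j x hx => ?_⟩
    rw [norm_smul, Real.norm_of_nonneg (by positivity)]
    calc (2 : ℝ) ^ j * ‖dyadicConv μ (L.precompR E) f (fderiv ℝ φ) j x‖
        ≤ 2 ^ j * (C * ((2 : ℝ) ^ (-α)) ^ j) := by
          gcongr
          refine (hC j x hx).trans ?_
          gcongr
          exact (hhalf j).trans (by gcongr)
      _ = C * (2 * (2 : ℝ) ^ (-α)) ^ j := by rw [mul_pow]; ring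

theorem HolderOnBalls.ckHolder_dyadicSum (hα : 0 < α) (h1 : α < 1) {f : E → F}
    (hf : HolderOnBalls α f) (d : ℕ) :
    ∀ {G H : Type} [NormedAddCommGroup G] [NormedSpace ℝ G] [NormedAddCommGroup H]
      [NormedSpace ℝ H] [CompleteSpace G] [CompleteSpace H] (L : F →L[ℝ] G →L[ℝ] H) {φ : E → G}
      (s : ℕ), IsUnitBump φ → s + d = finrank ℝ E → (d = 0 → ∫ z, φ z ∂μ = 0) →
      CkHolder d α (dyadicSum μ L f φ s) := by
  have hρ0 : (0 : ℝ) < (2 : ℝ) ^ (-α) := by positivity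
  have hρ1 : (2 : ℝ) ^ (-α) < 1 := Real.rpow_lt_one_of_one_lt_of_neg one_lt_two (by linarith)
  have hcont := hf.continuous hα
  induction d with
  | zero =>
    intro G H _ _ _ _ _ _ L φ s hφ hs h0
    rw [ckHolder_zero_iff hα]
    rw [add_zero] at hs
    unfold dyadicSum
    refine holderOnBalls_tsum hα h1 (fun j x =>
      (hasFDerivAt_dyadicConv hcont.locallyIntegrable hφ j x).const_smul _) (fun R => ?_) fun R => ?_
    · obtain ⟨C, hC0, hC⟩ := exists_norm_dyadicConv_le_of_integral_eq_zero (L := L) hα hf hφ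
        (h0 rfl) R
      refine ⟨C, hC0, fun j x hx => ?_⟩
      rw [norm_smul, Real.norm_of_nonneg (by positivity), hs, ← le_div_iff₀' (by positivity),
        div_eq_mul_inv]
      exact hC j x hx
    · obtain ⟨C, hC0, hC⟩ := exists_norm_dyadicConv_le_of_integral_eq_zero (L := L.precompR E)
        hα hf hφ.fderiv (integral_fderiv_eq_zero (μ := μ) hφ) R
      refine ⟨C, hC0, fun j x hx => ?_⟩
      rw [norm_smul, norm_smul, Real.norm_of_nonneg (by positivity),
        Real.norm_of_nonneg (by positivity), hs]
      calc ((2 : ℝ) ^ j) ^ finrank ℝ E *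
            (2 ^ j * ‖dyadicConv μ (L.precompR E) f (fderiv ℝ φ) j x‖)
          ≤ ((2 : ℝ) ^ j) ^ finrank ℝ E * (2 ^ j *
              (C * ((2 : ℝ) ^ (-α)) ^ j * (((2 : ℝ) ^ j) ^ finrank ℝ E)⁻¹)) := by
            gcongr; exact hC j x hx
        _ = C * (2 * (2 : ℝ) ^ (-α)) ^ j := by
            rw [mul_pow]; field_simp
  | succ d ih =>
    intro G H _ _ _ _ _ _ L φ s hφ hs _
    refine CkHolder.of_hasFDerivAt (f' := dyadicSum μ (L.precompR E) f (fderiv ℝ φ) (s + 1)) ?_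
      (ih _ _ hφ.fderiv (by omega) fun _ => integral_fderiv_eq_zero hφ)
    have hW (j : ℕ) (x : E) : HasFDerivAt (fun x => ((2 : ℝ) ^ j) ^ s • dyadicConv μ L f φ j x)
        (((2 : ℝ) ^ j) ^ (s + 1) • dyadicConv μ (L.precompR E) f (fderiv ℝ φ) j x) x := by
      rw [pow_succ, mul_smul]
      exact (hasFDerivAt_dyadicConv hcont.locallyIntegrable hφ j x).const_smul _
    intro x
    refine hasFDerivAt_tsum_of_geometric_bound hρ0.le hρ1 hW
      (summable_smul_dyadicConv hcont.bddOnBalls hφ (by omega)) (fun R => ?_) x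
    obtain ⟨C, hC0, hC⟩ := exists_norm_dyadicConv_le_of_integral_eq_zero (L := L.precompR E)
      hα hf hφ.fderiv (integral_fderiv_eq_zero (μ := μ) hφ) R
    refine ⟨C, hC0, fun j x hx => ?_⟩
    rw [norm_smul, Real.norm_of_nonneg (by positivity), ← le_div_iff₀' (by positivity),
      div_eq_mul_inv]
    refine (hC j x hx).trans ?_
    have : (1 : ℝ) ≤ 2 ^ j := one_le_pow₀ one_le_two
    gcongr
    omega

theorem CkHolder.dyadicSum [CompleteSpace G] (hα : 0 < α) (h1 : α < 1) (hE : 0 < finrank ℝ E)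
    {φ : E → G} (hφ : IsUnitBump φ) {i : ℕ} :
    ∀ {F H : Type} [NormedAddCommGroup F] [NormedSpace ℝ F] [NormedAddCommGroup H]
      [NormedSpace ℝ H] [CompleteSpace H] {L : F →L[ℝ] G →L[ℝ] H} {f : E → F},
      CkHolder i α f → CkHolder (finrank ℝ E + i) α (dyadicSum μ L f φ 0) := by
  induction i with
  | zero =>
    intro F H _ _ _ _ _ L f hf
    rw [ckHolder_zero_iff hα] at hf
    exact hf.ckHolder_dyadicSum hα h1 _ L 0 hφ (by simp) fun h => absurd h hE.ne'
  | succ i ih =>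
    intro F H _ _ _ _ _ L f hf
    have hf1 : ContDiff ℝ 1 f := hf.1.of_le (by norm_cast; omega)
    rw [ckHolder_succ_iff] at hf
    refine CkHolder.of_hasFDerivAt ?_ (ih (L := L.precompL E) hf.2)
    intro x
    have hW (j : ℕ) (x : E) : HasFDerivAt (fun x => ((2 : ℝ) ^ j) ^ 0 • dyadicConv μ L f φ j x)
        (((2 : ℝ) ^ j) ^ 0 • dyadicConv μ (L.precompL E) (fderiv ℝ f) φ j x) x :=
      (hasFDerivAt_dyadicConv_left hf1 hφ j x).const_smul _
    refine hasFDerivAt_tsum_of_geometric_bound (ρ := 1 / 2) (by norm_num) (by norm_num) hW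
      (summable_smul_dyadicConv hf1.continuous.bddOnBalls hφ hE) (fun R => ?_) x
    obtain ⟨C, hC0, hC⟩ := exists_norm_dyadicConv_le (μ := μ) (L := L.precompL E)
      (hf1.continuous_fderiv one_ne_zero).bddOnBalls hφ R
    refine ⟨C, hC0, fun j x hx => ?_⟩
    rw [pow_zero, one_smul]
    refine (hC j x hx).trans ?_
    gcongr
    simpa using pow_mul_inv_pow_le_half_pow hE j

end DyadicSum

section LogKernel

open Module (finrank)

variable {E : Type} [NormedAddCommGroup E] [InnerProductSpace ℝ E] [FiniteDimensional ℝ E]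

theorem exists_contDiff_eq_log_norm (E : Type) [NormedAddCommGroup E] [InnerProductSpace ℝ E]
    [FiniteDimensional ℝ E] :
    ∃ ψ : E → ℝ, ContDiff ℝ (⊤ : ℕ∞) ψ ∧ ∀ z, 1 ≤ ‖z‖ → ψ z = log ‖z‖ := by
  let χ : ContDiffBump (0 : E) := ⟨1 / 2, 1, by norm_num, by norm_num⟩
  refine ⟨fun z => (1 - χ z) * log ‖z‖, contDiff_iff_contDiffAt.2 fun z => ?_, fun z hz => ?_⟩
  · rcases eq_or_ne z 0 with rfl | hz
    · refine (contDiffAt_const (c := (0 : ℝ))).congr_of_eventuallyEq ?_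
      filter_upwards [χ.eventuallyEq_one] with z hz
      simp [hz]
    · exact (contDiffAt_const.sub χ.contDiff.contDiffAt).mul
        ((contDiffAt_norm ℝ hz).log (norm_ne_zero_iff.2 hz))
  · have : χ z = 0 := χ.zero_of_le_dist (by simpa [χ] using hz)
    simp [this]

theorem isUnitBump_of_eq_log_norm {ψ : E → ℝ} (hψ : ContDiff ℝ (⊤ : ℕ∞) ψ)
    (hlog : ∀ z, 1 ≤ ‖z‖ → ψ z = log ‖z‖) :
    IsUnitBump fun z => ψ ((2 : ℝ) • z) - ψ z - log 2 := by
  refine ⟨((hψ.comp (contDiff_const_smul _)).sub hψ).sub contDiff_const,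
    closure_minimal (fun z hz => ?_) isClosed_closedBall⟩
  by_contra h
  rw [mem_closedBall_zero_iff, not_le] at h
  have h2 : ‖(2 : ℝ) • z‖ = 2 * ‖z‖ := by rw [norm_smul, Real.norm_ofNat]
  refine hz ?_
  simp only
  rw [hlog z h.le, hlog _ (by rw [h2]; linarith), h2, Real.log_mul two_ne_zero (by positivity)]
  ring

theorem hasSum_dyadicDilate_log {ψ : E → ℝ} (hlog : ∀ z, 1 ≤ ‖z‖ → ψ z = log ‖z‖) {z : E}
    (hz : z ≠ 0) :
    HasSum (fun j => dyadicDilate (fun z => ψ ((2 : ℝ) • z) - ψ z - log 2) j z)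
      (log ‖z‖ - ψ z) := by
  have hz' : 0 < ‖z‖ := norm_pos_iff.2 hz
  have hval (j : ℕ) (hj : 1 ≤ 2 ^ j * ‖z‖) : ψ ((2 : ℝ) ^ j • z) = j * log 2 + log ‖z‖ := by
    have h2 : ‖(2 : ℝ) ^ j • z‖ = 2 ^ j * ‖z‖ := by rw [norm_smul, norm_pow, Real.norm_ofNat]
    rw [hlog _ (by rwa [h2]), h2, Real.log_mul (by positivity) hz'.ne', Real.log_pow]
  obtain ⟨N, hN⟩ := pow_unbounded_of_one_lt ‖z‖⁻¹ one_lt_two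
  rw [inv_lt_iff_one_lt_mul₀ hz'] at hN
  have hsum (M : ℕ) :
      ∑ j ∈ Finset.range M, dyadicDilate (fun z => ψ ((2 : ℝ) • z) - ψ z - log 2) j z =
        ψ ((2 : ℝ) ^ M • z) - ψ z - M * log 2 := by
    induction M with
    | zero => simp
    | succ M ih =>
      rw [Finset.sum_range_succ, ih, dyadicDilate, smul_smul, ← pow_succ']
      push_cast
      ring
  have hlim : log ‖z‖ - ψ z =
      ∑ j ∈ Finset.range N, dyadicDilate (fun z => ψ ((2 : ℝ) • z) - ψ z - log 2) j z := by
    rw [hsum, hval N hN.le]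
    ring
  rw [hlim]
  refine hasSum_sum_of_ne_finset_zero fun j hj => ?_
  have hle : (2 : ℝ) ^ N ≤ 2 ^ j :=
    pow_le_pow_right₀ one_le_two (not_lt.1 fun h => hj (Finset.mem_range.2 h))
  have hj1 : 1 ≤ 2 ^ j * ‖z‖ := hN.le.trans (by gcongr)
  have hj2 : 1 ≤ 2 ^ (j + 1) * ‖z‖ := by rw [pow_succ]; linarith
  rw [dyadicDilate, smul_smul, ← pow_succ', hval _ hj1, hval _ hj2]
  push_cast
  ring

variable [MeasurableSpace E] [BorelSpace E] {μ : Measure E} [μ.IsAddHaarMeasure]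

theorem hasFDerivAt_integral_smul_comp_sub {F : Type} [NormedAddCommGroup F] [NormedSpace ℝ F]
    {f : E → ℝ} (hf : Integrable f μ) {g : E → F} (hg : ContDiff ℝ 1 g) {C : ℝ}
    (hC : ∀ z, ‖fderiv ℝ g z‖ ≤ C) {w : E → F}
    (hw : ∀ x, Integrable (fun y => f y • (g (x - y) - w y)) μ) (x : E) :
    HasFDerivAt (fun x => ∫ y, f y • (g (x - y) - w y) ∂μ)
      (∫ y, f y • fderiv ℝ g (x - y) ∂μ) x := by
  refine hasFDerivAt_integral_of_dominated_of_fderiv_le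
    (F' := fun x y => f y • fderiv ℝ g (x - y)) (bound := fun y => ‖f y‖ * C)
    Filter.univ_mem (.of_forall fun z => (hw z).aestronglyMeasurable) (hw x) ?_ ?_
    (hf.norm.mul_const C) ?_
  · exact hf.aestronglyMeasurable.smul (((hg.continuous_fderiv one_ne_zero).comp
      (continuous_const.sub continuous_id)).aestronglyMeasurable)
  · refine .of_forall fun y z _ => ?_
    rw [norm_smul]
    gcongr
    exact hC _
  · refine .of_forall fun y z _ => ?_
    have h1 : HasFDerivAt (fun z => g (z - y)) (fderiv ℝ g (z - y)) z := by
      have := ((hg.differentiable one_ne_zero) (z - y)).hasFDerivAt.comp z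
        ((hasFDerivAt_id z).sub_const y)
      simpa [Function.comp_def] using this
    exact (h1.sub_const _).const_smul _

theorem exists_norm_le_of_dilation_eq {F : Type} [NormedAddCommGroup F] [NormedSpace ℝ F]
    {g η : E → F} (hg : Continuous g) (hη : IsUnitBump η) {a : ℝ} (ha : 2 ≤ a)
    (h : ∀ z, a • g ((2 : ℝ) • z) = g z + η z) : ∃ C, ∀ z, ‖g z‖ ≤ C := by
  obtain ⟨M, hM0, hM⟩ := hg.bddOnBalls 1
  obtain ⟨M', hM'⟩ := hη.hasCompactSupport.exists_bound_of_continuous hη.contDiff.continuous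
  have main (N : ℕ) : ∀ z, ‖z‖ ≤ 2 ^ N → ‖g z‖ ≤ max M M' := by
    induction N with
    | zero => exact fun z hz => (hM z (by simpa using hz)).trans (le_max_left _ _)
    | succ N ih =>
      intro z hz
      have hz2 : (2 : ℝ) • ((1 / 2 : ℝ) • z) = z := by rw [smul_smul]; norm_num
      have h1 := h ((1 / 2 : ℝ) • z)
      rw [hz2] at h1
      have h2 := ih ((1 / 2 : ℝ) • z) (by
        rw [norm_smul, Real.norm_of_nonneg (by norm_num)]
        rw [pow_succ] at hz
        linarith)
      have h3 : a * ‖g z‖ ≤ max M M' + max M M' := by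
        rw [← Real.norm_of_nonneg (by linarith : 0 ≤ a), ← norm_smul, h1]
        exact (norm_add_le _ _).trans (add_le_add h2 ((hM' _).trans (le_max_right _ _)))
      nlinarith [norm_nonneg (g z)]
  refine ⟨max M M', fun z => ?_⟩
  obtain ⟨N, hN⟩ := pow_unbounded_of_one_lt ‖z‖ one_lt_two
  exact main N z hN.le

theorem fderiv_dilation_eq {F : Type} [NormedAddCommGroup F] [NormedSpace ℝ F]
    {g η : E → F} (hg : Differentiable ℝ g) (hη : Differentiable ℝ η) {a : ℝ}
    (h : ∀ z, a • g ((2 : ℝ) • z) = g z + η z) (z : E) :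
    (2 * a) • fderiv ℝ g ((2 : ℝ) • z) = fderiv ℝ g z + fderiv ℝ η z := by
  have h1 : HasFDerivAt (fun z : E => (2 : ℝ) • z) ((2 : ℝ) • ContinuousLinearMap.id ℝ E) z :=
    (hasFDerivAt_id z).const_smul _
  have h2 := ((hg ((2 : ℝ) • z)).hasFDerivAt.comp z h1).const_smul a
  have h3 := (hg z).hasFDerivAt.add (hη z).hasFDerivAt
  rw [← h2.unique (h3.congr_of_eventuallyEq (.of_forall fun z => h z))]
  ext v
  simp [smul_smul, mul_comm]

theorem contDiff_integral_smul_comp_sub {f : E → ℝ} (hf : Integrable f μ) {m : ℕ} :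
    ∀ {F : Type} [NormedAddCommGroup F] [NormedSpace ℝ F] {g η : E → F} {a : ℝ},
      ContDiff ℝ (⊤ : ℕ∞) g → IsUnitBump η → 2 ≤ a →
      (∀ z, a • g ((2 : ℝ) • z) = g z + η z) →
      ContDiff ℝ m fun x => ∫ y, f y • g (x - y) ∂μ := by
  have hderiv {F : Type} [NormedAddCommGroup F] [NormedSpace ℝ F] {g η : E → F} {a : ℝ}
      (hg : ContDiff ℝ (⊤ : ℕ∞) g) (hη : IsUnitBump η) (ha : 2 ≤ a)
      (h : ∀ z, a • g ((2 : ℝ) • z) = g z + η z) (x : E) :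
      HasFDerivAt (fun x => ∫ y, f y • g (x - y) ∂μ) (∫ y, f y • fderiv ℝ g (x - y) ∂μ) x := by
    obtain ⟨C, hC⟩ := exists_norm_le_of_dilation_eq hg.continuous hη ha h
    obtain ⟨C', hC'⟩ := exists_norm_le_of_dilation_eq (a := 2 * a)
      (hg.continuous_fderiv (by simp)) hη.fderiv (by linarith)
      (fderiv_dilation_eq (hg.differentiable (by simp)) (hη.contDiff.differentiable (by simp)) h)
    have hint (x : E) : Integrable (fun y => f y • (g (x - y) - (fun _ => 0 : E → F) y)) μ := by
      simp only [sub_zero]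
      refine (hf.norm.mul_const C).mono' (hf.aestronglyMeasurable.smul
        (hg.continuous.comp (continuous_const.sub continuous_id)).aestronglyMeasurable)
        (.of_forall fun y => ?_)
      rw [norm_smul]
      gcongr
      exact hC _
    simpa using hasFDerivAt_integral_smul_comp_sub hf (hg.of_le (by simp)) hC' hint x
  induction m with
  | zero =>
    intro F _ _ g η a hg hη ha h
    exact contDiff_zero.2 (continuous_iff_continuousAt.2 fun x =>
      (hderiv hg hη ha h x).continuousAt)
  | succ m ih =>
    intro F _ _ g η a hg hη ha h
    push_cast
    refine contDiff_succ_iff_hasFDerivAt.2 ⟨_, ?_, hderiv hg hη ha h⟩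
    exact ih (a := 2 * a) (hg.fderiv_right (by simp)) hη.fderiv (by linarith)
      (fderiv_dilation_eq (hg.differentiable (by simp)) (hη.contDiff.differentiable (by simp)) h)

theorem exists_fderiv_dilation_eq_of_eq_log_norm {ψ : E → ℝ} (hψ : ContDiff ℝ (⊤ : ℕ∞) ψ)
    (hlog : ∀ z, 1 ≤ ‖z‖ → ψ z = log ‖z‖) :
    ∃ η : E → E →L[ℝ] ℝ, IsUnitBump η ∧
      ∀ z, (2 : ℝ) • fderiv ℝ ψ ((2 : ℝ) • z) = fderiv ℝ ψ z + η z := by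
  have hφ := isUnitBump_of_eq_log_norm hψ hlog
  refine ⟨_, hφ.fderiv, fun z => ?_⟩
  have h := fderiv_dilation_eq (a := 1) (g := ψ)
    (η := fun z => ψ ((2 : ℝ) • z) - ψ z - log 2 + log 2) (hψ.differentiable (by simp))
    ((hφ.contDiff.add contDiff_const).differentiable (by simp)) (fun z => by simp) z
  rwa [fderiv_add_const, mul_one] at h

theorem integrable_mul_sub_of_eq_log_norm {f ψ : E → ℝ} (hf : Integrable f μ)
    (hψ : ContDiff ℝ (⊤ : ℕ∞) ψ) (hlog : ∀ z, 1 ≤ ‖z‖ → ψ z = log ‖z‖) (x : E) :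
    Integrable (fun y => f y * (ψ (x - y) - ψ (0 - y))) μ := by
  obtain ⟨η, hη, h⟩ := exists_fderiv_dilation_eq_of_eq_log_norm hψ hlog
  obtain ⟨C, hC⟩ := exists_norm_le_of_dilation_eq (hψ.continuous_fderiv (by simp)) hη le_rfl h
  refine (hf.norm.mul_const (C * ‖x‖)).mono' (hf.aestronglyMeasurable.mul
    ((hψ.continuous.comp (continuous_const.sub continuous_id)).sub
      (hψ.continuous.comp (continuous_const.sub continuous_id))).aestronglyMeasurable)
    (.of_forall fun y => ?_)
  rw [norm_mul]
  gcongr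
  have := convex_univ.norm_image_sub_le_of_norm_fderiv_le
    (fun z _ => (hψ.differentiable (by simp)) z) (fun z _ => hC z) (Set.mem_univ (0 - y))
    (Set.mem_univ (x - y))
  simpa using this

theorem contDiff_integral_mul_sub_of_eq_log_norm {f ψ : E → ℝ} (hf : Integrable f μ)
    (hψ : ContDiff ℝ (⊤ : ℕ∞) ψ) (hlog : ∀ z, 1 ≤ ‖z‖ → ψ z = log ‖z‖) (m : ℕ) :
    ContDiff ℝ m fun x => ∫ y, f y * (ψ (x - y) - ψ (0 - y)) ∂μ := by
  obtain ⟨η, hη, h⟩ := exists_fderiv_dilation_eq_of_eq_log_norm hψ hlog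
  obtain ⟨C, hC⟩ := exists_norm_le_of_dilation_eq (hψ.continuous_fderiv (by simp)) hη le_rfl h
  have h1 : ContDiff ℝ ((m : WithTop ℕ∞) + 1)
      fun x => ∫ y, f y • (ψ (x - y) - ψ (0 - y)) ∂μ :=
    contDiff_succ_iff_hasFDerivAt.2 ⟨_,
      contDiff_integral_smul_comp_sub hf (hψ.fderiv_right (by simp)) hη le_rfl h,
      hasFDerivAt_integral_smul_comp_sub hf (hψ.of_le (by simp)) hC
        (w := fun y => ψ (0 - y)) (integrable_mul_sub_of_eq_log_norm hf hψ hlog)⟩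
  exact h1.of_le (by norm_cast; omega)

theorem integrable_and_hasSum_integral_of_ae_hasSum {X F : Type} [MeasurableSpace X] {ν : Measure X}
    [NormedAddCommGroup F] [NormedSpace ℝ F] {f : ℕ → X → F} {g : X → F}
    (hg : AEStronglyMeasurable g ν) (hf : ∀ j, Integrable (f j) ν)
    (hs : Summable fun j => ∫ x, ‖f j x‖ ∂ν) (hfg : ∀ᵐ x ∂ν, HasSum (fun j => f j x) (g x)) :
    Integrable g ν ∧ HasSum (fun j => ∫ x, f j x ∂ν) (∫ x, g x ∂ν) := by
  refine ⟨⟨hg, ?_⟩, ?_⟩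
  · calc ∫⁻ x, ‖g x‖ₑ ∂ν ≤ ∫⁻ x, ∑' j, ‖f j x‖ₑ ∂ν := by
          refine lintegral_mono_ae (hfg.mono fun x hx => ?_)
          rw [← hx.tsum_eq]
          exact enorm_tsum_le_tsum_enorm
      _ = ∑' j, ENNReal.ofReal (∫ x, ‖f j x‖ ∂ν) := by
          rw [lintegral_tsum fun j => (hf j).aestronglyMeasurable.enorm]
          simp_rw [fun j => ofReal_integral_norm_eq_lintegral_enorm (hf j)]
      _ = ENNReal.ofReal (∑' j, ∫ x, ‖f j x‖ ∂ν) :=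
          (ENNReal.ofReal_tsum_of_nonneg
            (fun j => integral_nonneg fun _ => norm_nonneg _) hs).symm
      _ < ⊤ := ENNReal.ofReal_lt_top
  · rw [integral_congr_ae (hfg.mono fun x hx => hx.tsum_eq.symm)]
    exact hasSum_integral_of_summable_integral_norm hf hs

theorem integrable_and_integral_mul_log_sub [Nontrivial E] {f ψ : E → ℝ} (hf : Integrable f μ)
    (hfb : BddOnBalls f) (hψ : ContDiff ℝ (⊤ : ℕ∞) ψ) (hlog : ∀ z, 1 ≤ ‖z‖ → ψ z = log ‖z‖)
    (x : E) :
    Integrable (fun y => f y * (log ‖x - y‖ - ψ (x - y))) μ ∧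
      ∫ y, f y * (log ‖x - y‖ - ψ (x - y)) ∂μ = dyadicSum μ (ContinuousLinearMap.mul ℝ ℝ) f
        (fun z => ψ ((2 : ℝ) • z) - ψ z - log 2) 0 x := by
  have hφ := isUnitBump_of_eq_log_norm hψ hlog
  obtain ⟨M, hM0, hM⟩ := hfb (‖x‖ + 1)
  have hM' (j : ℕ) (y : E) (hy : ‖x - y‖ ≤ ((2 : ℝ) ^ j)⁻¹) : ‖f y‖ ≤ M := by
    refine hM y ?_
    have h1 : ((2 : ℝ) ^ j)⁻¹ ≤ 1 := inv_le_one_of_one_le₀ (one_le_pow₀ one_le_two)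
    have h2 := norm_sub_norm_le y x
    rw [norm_sub_rev] at h2
    linarith
  obtain ⟨h1, h2⟩ := integrable_and_hasSum_integral_of_ae_hasSum (ν := μ)
    (f := fun j y => ContinuousLinearMap.mul ℝ ℝ (f y)
      (dyadicDilate (fun z => ψ ((2 : ℝ) • z) - ψ z - log 2) j (x - y)))
    (g := fun y => f y * (log ‖x - y‖ - ψ (x - y)))
    (hf.aestronglyMeasurable.mul (Measurable.aestronglyMeasurable
      ((Real.measurable_log.comp (measurable_norm.comp (measurable_const.sub measurable_id))).sub
        (hψ.continuous.measurable.comp (measurable_const.sub measurable_id)))))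
    (fun j => integrable_bilinear_dilate hf.locallyIntegrable hφ j x)
    (by
      refine .of_nonneg_of_le (fun j => integral_nonneg fun _ => norm_nonneg _) (fun j =>
        (integral_norm_bilinear_dilate_le hφ (hM' j)).trans ?_)
        ((summable_geometric_of_lt_one (r := (1 / 2 : ℝ)) (by norm_num) (by norm_num)).mul_left
          (‖ContinuousLinearMap.mul ℝ ℝ‖ * M *
            ∫ z, ‖ψ ((2 : ℝ) • z) - ψ z - log 2‖ ∂μ))
      rw [mul_right_comm]
      gcongr
      simpa using pow_mul_inv_pow_le_half_pow (Module.finrank_pos (R := ℝ) (M := E)) j)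
    (by
      filter_upwards [Measure.ae_ne μ x] with y hy
      exact (hasSum_dyadicDilate_log hlog (sub_ne_zero.2 hy.symm)).mul_left (f y))
  refine ⟨h1, ?_⟩
  rw [← h2.tsum_eq]
  simp [dyadicSum, dyadicConv]

theorem integral_log_div_mul_eq [Nontrivial E] {f ψ : E → ℝ} (hf : Integrable f μ)
    (hfb : BddOnBalls f) (hψ : ContDiff ℝ (⊤ : ℕ∞) ψ) (hlog : ∀ z, 1 ≤ ‖z‖ → ψ z = log ‖z‖)
    {φ : E → ℝ} (hφ : φ = fun z => ψ ((2 : ℝ) • z) - ψ z - log 2) (x : E) :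
    ∫ y, log (‖y‖ / ‖x - y‖) * f y ∂μ =
      dyadicSum μ (ContinuousLinearMap.mul ℝ ℝ) f φ 0 0 -
        dyadicSum μ (ContinuousLinearMap.mul ℝ ℝ) f φ 0 x -
        ∫ y, f y * (ψ (x - y) - ψ (0 - y)) ∂μ := by
  obtain ⟨h0, h0'⟩ := integrable_and_integral_mul_log_sub hf hfb hψ hlog (0 : E)
  obtain ⟨hx, hx'⟩ := integrable_and_integral_mul_log_sub hf hfb hψ hlog x
  have h0x : Integrable (fun y => f y * (log ‖0 - y‖ - ψ (0 - y)) -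
      f y * (log ‖x - y‖ - ψ (x - y))) μ := h0.sub hx
  rw [hφ, ← h0', ← hx', ← integral_sub h0 hx,
    ← integral_sub h0x (integrable_mul_sub_of_eq_log_norm hf hψ hlog x)]
  refine integral_congr_ae ?_
  filter_upwards [Measure.ae_ne μ x, Measure.ae_ne μ (0 : E)] with y hy hy0
  rw [Real.log_div (norm_ne_zero_iff.2 hy0) (norm_ne_zero_iff.2 (sub_ne_zero.2 hy.symm))]
  simp only [zero_sub, norm_neg]
  ring

end LogKernel

section LogPotential

open Module (finrank)

variable {E : Type} [NormedAddCommGroup E] [InnerProductSpace ℝ E] [FiniteDimensional ℝ E]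
  [Nontrivial E] [MeasurableSpace E] [BorelSpace E] {μ : Measure E} [μ.IsAddHaarMeasure] {α : ℝ}
  {f : E → ℝ}

theorem exists_integral_log_div_mul_eq_add_dyadicSum (hf : Integrable f μ)
    (hfb : BddOnBalls f) :
    ∃ P φ : E → ℝ, (∀ m : ℕ, ContDiff ℝ m P) ∧ IsUnitBump φ ∧
      (fun x => ∫ y, log (‖y‖ / ‖x - y‖) * f y ∂μ) =
        fun x => P x + (-1 : ℝ) • dyadicSum μ (ContinuousLinearMap.mul ℝ ℝ) f φ 0 x := by
  obtain ⟨ψ, hψ, hlog⟩ := exists_contDiff_eq_log_norm E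
  set φ : E → ℝ := fun z => ψ ((2 : ℝ) • z) - ψ z - log 2 with hφ
  refine ⟨fun x => dyadicSum μ (ContinuousLinearMap.mul ℝ ℝ) f φ 0 0 -
    ∫ y, f y * (ψ (x - y) - ψ (0 - y)) ∂μ, φ, fun m => contDiff_const.sub
    (contDiff_integral_mul_sub_of_eq_log_norm hf hψ hlog m),
    isUnitBump_of_eq_log_norm hψ hlog, funext fun x => ?_⟩
  rw [integral_log_div_mul_eq hf hfb hψ hlog hφ x, neg_one_smul, ← sub_eq_add_neg]
  exact sub_right_comm _ _ _

theorem ckHolder_zero_integral_log_div_mul (hα : 0 < α) (h1 : α < 1) (hf : Integrable f μ)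
    (hfb : BddOnBalls f) : CkHolder 0 α fun x => ∫ y, log (‖y‖ / ‖x - y‖) * f y ∂μ := by
  obtain ⟨P, φ, hP, hφ, h⟩ := exists_integral_log_div_mul_eq_add_dyadicSum hf hfb
  rw [h]
  exact ((hP _).ckHolder h1.le).add (((ckHolder_zero_iff hα).2
    (holderOnBalls_dyadicSum_of_bddOnBalls hα h1 Module.finrank_pos hf.locallyIntegrable hfb
      hφ)).const_smul _)

theorem CkHolder.integral_log_div_mul {k : ℕ} (hα : 0 < α) (h1 : α < 1) (hf : Integrable f μ)
    (hfk : CkHolder k α f) :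
    CkHolder (finrank ℝ E + k) α fun x => ∫ y, log (‖y‖ / ‖x - y‖) * f y ∂μ := by
  obtain ⟨P, φ, hP, hφ, h⟩ :=
    exists_integral_log_div_mul_eq_add_dyadicSum hf hfk.1.continuous.bddOnBalls
  rw [h]
  exact ((hP _).ckHolder h1.le).add ((hfk.dyadicSum hα h1 Module.finrank_pos hφ).const_smul _)

theorem CkHolder.of_eq_integral_log_div_mul {k : ℕ} {K u : E → ℝ} {a c : ℝ} (hα : 0 < α)
    (h1 : α < 1) (hK : CkHolder k α K) (hu : BddOnBalls u)
    (hint : Integrable (fun y => K y * Real.exp (a * u y)) μ)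
    (heq : u = fun x => c * ∫ y, log (‖y‖ / ‖x - y‖) * (K y * Real.exp (a * u y)) ∂μ) :
    CkHolder (finrank ℝ E + k) α u := by
  have hbdd : BddOnBalls fun y => K y * Real.exp (a * u y) := by
    intro R
    obtain ⟨M, hM0, hM⟩ := hK.1.continuous.bddOnBalls R
    obtain ⟨N, hN0, hN⟩ := hu R
    refine ⟨M * Real.exp (|a| * N), by positivity, fun x hx => ?_⟩
    rw [norm_mul, Real.norm_of_nonneg (Real.exp_pos _).le]
    refine mul_le_mul (hM x hx) (Real.exp_le_exp.2 ?_) (Real.exp_pos _).le hM0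
    · refine (le_abs_self _).trans ?_
      rw [abs_mul]
      refine mul_le_mul_of_nonneg_left ?_ (abs_nonneg a)
      exact hN x hx
  have hstep {i : ℕ} (hi : i ≤ k) (hui : CkHolder i α u) : CkHolder (finrank ℝ E + i) α u := by
    have hf : CkHolder i α fun y => K y * Real.exp (a * u y) :=
      (hK.of_le h1.le hi).bilinear hα h1.le ((hui.const_smul a).exp hα h1.le)
        (ContinuousLinearMap.mul ℝ ℝ)
    rw [heq]
    exact (hf.integral_log_div_mul hα h1 hint).const_smul c
  refine hstep le_rfl ?_
  suffices ∀ i ≤ k, CkHolder i α u from this k le_rfl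
  intro i
  induction i with
  | zero =>
    intro _
    rw [heq]
    exact (ckHolder_zero_integral_log_div_mul hα h1 hint hbdd).const_smul c
  | succ i ih =>
    intro hi
    have hE : 0 < finrank ℝ E := Module.finrank_pos
    exact (hstep (by omega) (ih (by omega))).of_le h1.le (by omega)

end LogPotential

theorem ckHolderLoc_iff_ckHolder {n k : ℕ} {α : NNReal} (hα : 0 < α) (h1 : α ≤ 1)
    {f : EuclideanSpace ℝ (Fin n) → ℝ} : CkHolderLoc k α f ↔ CkHolder k (α : ℝ) f := by
  refine ⟨fun hf => ⟨hf.1, .of_locally hα fun x₀ => ?_⟩, fun hf => ⟨hf.1, fun i hi x₀ => ?_⟩⟩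
  · obtain ⟨C, s, hs, hC⟩ := hf.2 k le_rfl x₀
    refine ⟨C, C.coe_nonneg, s, hs, fun x hx y hy => ?_⟩
    have h := hC.dist_le hx hy
    rw [dist_eq_norm, dist_eq_norm] at h
    exact h
  · obtain ⟨C, hC0, hC⟩ := (hf.of_le (by exact_mod_cast h1) hi).2 (‖x₀‖ + 1)
    refine ⟨C.toNNReal, closedBall 0 (‖x₀‖ + 1), closedBall_mem_nhds_of_mem (by simp),
      fun x hx y hy => ?_⟩
    have h := hC x y (mem_closedBall_zero_iff.1 hx) (mem_closedBall_zero_iff.1 hy)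
    rw [edist_eq_enorm_sub, edist_eq_enorm_sub, ← ofReal_norm, ← ofReal_norm,
      ENNReal.ofReal_rpow_of_nonneg (norm_nonneg _) α.coe_nonneg]
    exact (ENNReal.ofReal_le_ofReal h).trans_eq (ENNReal.ofReal_mul hC0)

/-- Regularity for the integral equation: if `K ∈ C^{k,α}_loc(ℝⁿ)` (`n` even) and
`u ∈ L^∞_loc(ℝⁿ)` solves `u(x) = (2/ω_n) ∫ log(|y|/|x−y|) K(y) e^{n u(y)} dy` with
`K e^{nu} ∈ L¹(ℝⁿ)`, then `u ∈ C^{n+k,α}_loc(ℝⁿ)`; if moreover `K` is smooth, so is `u`. -/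
theorem regularity_integral_equation (n : ℕ) (hn : 0 < n) (hne : Even n)
    (k : ℕ) (α : NNReal) (hα0 : 0 < α) (hα1 : α < 1)
    (K u : EuclideanSpace ℝ (Fin n) → ℝ)
    (hK : CkHolderLoc k α K) (hu : LocBdd u)
    (hint : Integrable (fun y : EuclideanSpace ℝ (Fin n) => K y * Real.exp (n * u y)))
    (hIE : ∀ x : EuclideanSpace ℝ (Fin n),
      u x = (2 / sphereVol n) * ∫ y, Real.log (‖y‖ / ‖x - y‖) * (K y * Real.exp (n * u y))) :
    CkHolderLoc (n + k) α u ∧ (ContDiff ℝ (⊤ : ℕ∞) K → ContDiff ℝ (⊤ : ℕ∞) u) := by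
  have : Nontrivial (EuclideanSpace ℝ (Fin n)) :=
    Module.nontrivial_of_finrank_pos (R := ℝ) (by simpa using hn)
  have hα0' : (0 : ℝ) < α := by exact_mod_cast hα0
  have hα1' : (α : ℝ) < 1 := by exact_mod_cast hα1
  have hub : BddOnBalls u := fun R =>
    let ⟨M, hM⟩ := hu R
    ⟨max M 0, le_max_right _ _, fun x hx => (hM x hx).trans (le_max_left _ _)⟩
  have key {j : ℕ} (hKj : CkHolder j (α : ℝ) K) : CkHolder (n + j) (α : ℝ) u := by
    simpa using hKj.of_eq_integral_log_div_mul hα0' hα1' hub hint (funext hIE)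
  refine ⟨(ckHolderLoc_iff_ckHolder hα0 hα1.le).2
    (key ((ckHolderLoc_iff_ckHolder hα0 hα1.le).1 hK)), fun hKs => ?_⟩
  refine contDiff_infty.2 fun j => ?_
  have hKj : CkHolder j (α : ℝ) K :=
    (hKs.of_le (by exact_mod_cast le_top (a := ((j + 1 : ℕ) : ℕ∞)))).ckHolder hα1'.le
  exact (key hKj).1.of_le (by exact_mod_cast Nat.le_add_left j n)
end

section
/- Let n ≥ 4 be an even integer and let f ∈ L¹(ℝ^n) be continuous. Define ũ(x) = (α_n/ω_n) ∫_{ℝ^n} log(|y|/|x−y|) f(y) dy, where α_n > 0 is the constant for which (−Δ)^{n/2} ũ = f. Then ∫_{B₁(x₀)} |Δũ(x)| dx → 0 as |x₀| → ∞; in particular |∫_{B₁(x₀)} Δũ dx| → 0 as |x₀| → ∞. -/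
open MeasureTheory Metric Real

/-- The Euclidean Laplacian of `u : ℝⁿ → ℝ` at `x`. -/
noncomputable def lap {n : ℕ} (u : EuclideanSpace ℝ (Fin n) → ℝ)
    (x : EuclideanSpace ℝ (Fin n)) : ℝ :=
  ∑ i : Fin n, iteratedFDeriv ℝ 2 u x (fun _ => EuclideanSpace.single i 1)

/-- The `m`-fold iterate `(−Δ)^m u` of the negative Laplacian. -/
noncomputable def negLapIter {n : ℕ} (m : ℕ) (u : EuclideanSpace ℝ (Fin n) → ℝ) :
    EuclideanSpace ℝ (Fin n) → ℝ :=
  (fun v x => -lap v x)^[m] u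

open Filter Topology Set

section Kernel

variable {E : Type*} [NormedAddCommGroup E] [InnerProductSpace ℝ E]

/-- First-order Taylor estimate for `log ‖·‖` which is uniform up to the singularity. -/
lemma abs_log_norm_add_sub_le {z v : E} (hz : z ≠ 0) (hzv : z + v ≠ 0) :
    |Real.log ‖z + v‖ - Real.log ‖z‖ - inner ℝ z v / ‖z‖ ^ 2| ≤
      2 * ‖v‖ ^ 2 * ((‖z‖ ^ 2)⁻¹ + (‖z + v‖ ^ 2)⁻¹) := by
  have hB := norm_add_sq_real z v
  have hcs := real_inner_mul_inner_self_le z v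
  rw [real_inner_self_eq_norm_sq, real_inner_self_eq_norm_sq] at hcs
  have hA0 : 0 < ‖z‖ ^ 2 := by positivity
  have hB0 : 0 < ‖z + v‖ ^ 2 := by positivity
  have hlog : Real.log ‖z + v‖ - Real.log ‖z‖
      = 1 / 2 * (Real.log (‖z + v‖ ^ 2) - Real.log (‖z‖ ^ 2)) := by
    rw [Real.log_pow, Real.log_pow]; push_cast; ring
  rw [hlog]
  generalize ‖z + v‖ ^ 2 = B at *
  generalize ‖z‖ ^ 2 = A at *
  have hq : 0 ≤ ‖v‖ ^ 2 := by positivity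
  generalize ‖v‖ ^ 2 = q at *
  generalize (inner ℝ z v : ℝ) = p at *
  have h1 : Real.log B - Real.log A ≤ B / A - 1 := by
    rw [← Real.log_div hB0.ne' hA0.ne']; exact Real.log_le_sub_one_of_pos (by positivity)
  have h2 : Real.log A - Real.log B ≤ A / B - 1 := by
    rw [← Real.log_div hA0.ne' hB0.ne']; exact Real.log_le_sub_one_of_pos (by positivity)
  rw [abs_le]
  constructor
  · have : 1 / 2 * (A / B - 1) + p / A ≤ 2 * q * (A⁻¹ + B⁻¹) := by
      have : 2 * q * (A⁻¹ + B⁻¹) - (1 / 2 * (A / B - 1) + p / A)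
          = (2 * q * (A + B) - (1 / 2 * (A - B) * A + p * B)) / (A * B) := by
        field_simp
        ring
      rw [← sub_nonneg, this]
      apply div_nonneg _ (by positivity)
      subst hB
      nlinarith [mul_nonneg hq hB0.le, mul_nonneg hq hA0.le]
    linarith
  · have : 1 / 2 * (B / A - 1) - p / A ≤ 2 * q * (A⁻¹ + B⁻¹) := by
      have h3 : 1 / 2 * (B / A - 1) - p / A = q / 2 * A⁻¹ := by
        field_simp; linarith
      rw [h3]
      have := mul_nonneg hq (inv_nonneg.2 hA0.le)
      have := mul_nonneg hq (inv_nonneg.2 hB0.le)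
      nlinarith
    linarith

lemma mul_inv_mul_inv_le (a b : ℝ) : a⁻¹ * b⁻¹ ≤ (a ^ 2)⁻¹ + (b ^ 2)⁻¹ := by
  rw [← inv_pow, ← inv_pow]
  nlinarith [sq_nonneg (a⁻¹ - b⁻¹), sq_nonneg a⁻¹, sq_nonneg b⁻¹]

lemma abs_inner_div_norm_sq_sub_le {z v : E} (e : E) (hz : z ≠ 0) (hzv : z + v ≠ 0) :
    |inner ℝ (z + v) e / ‖z + v‖ ^ 2 - inner ℝ z e / ‖z‖ ^ 2| ≤
      ‖v‖ * ‖e‖ * ((‖z‖ ^ 2)⁻¹ + (‖z + v‖ ^ 2)⁻¹) := by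
  have h := dist_div_norm_sq_smul hzv hz 1
  have h2 := abs_real_inner_le_norm ((1 / ‖z + v‖) ^ 2 • (z + v) - (1 / ‖z‖) ^ 2 • z) e
  rw [← dist_eq_norm, h, inner_sub_left, real_inner_smul_left, real_inner_smul_left] at h2
  have h3 := mul_inv_mul_inv_le ‖z‖ ‖z + v‖
  calc _ = |(1 / ‖z + v‖) ^ 2 * inner ℝ (z + v) e - (1 / ‖z‖) ^ 2 * inner ℝ z e| := by
        congr 1; simp only [one_div, inv_pow]; ring
    _ ≤ _ := h2
    _ = ‖v‖ * ‖e‖ * (‖z‖⁻¹ * ‖z + v‖⁻¹) := by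
        rw [dist_eq_norm, add_sub_cancel_left, one_pow, one_div, mul_inv]; ring
    _ ≤ _ := by gcongr

end Kernel

lemma inv_le_one_add_inv_sq (a : ℝ) : a⁻¹ ≤ 1 + (a ^ 2)⁻¹ := by
  rw [← inv_pow]; nlinarith [sq_nonneg (a⁻¹ - 1), sq_nonneg a⁻¹]

lemma abs_log_norm_div_norm_le {E : Type*} [NormedAddCommGroup E] (x y : E) :
    |Real.log (‖y‖ / ‖x - y‖)| ≤
      1 + 2 * ‖x‖ + ‖x‖ * (‖x - y‖ ^ 2)⁻¹ + ‖x‖ * (‖y‖ ^ 2)⁻¹ := by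
  have hx := norm_nonneg x
  have hR : 0 ≤ ‖x‖ * (‖x - y‖ ^ 2)⁻¹ := by positivity
  have hR' : 0 ≤ ‖x‖ * (‖y‖ ^ 2)⁻¹ := by positivity
  by_cases hy : y = 0
  · simp only [hy, norm_zero, zero_div, Real.log_zero, abs_zero]; positivity
  by_cases hxy : x - y = 0
  · simp only [hxy, norm_zero, div_zero, Real.log_zero, abs_zero]; positivity
  have hy0 : 0 < ‖y‖ := norm_pos_iff.2 hy
  have hxy0 : 0 < ‖x - y‖ := norm_pos_iff.2 hxy
  have key : ∀ a b : ℝ, 0 < a → 0 < b → a ≤ b + ‖x‖ →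
      Real.log (a / b) ≤ 1 + ‖x‖ * (1 + (b ^ 2)⁻¹) := by
    intro a b ha hb hab
    calc Real.log (a / b) ≤ a / b := Real.log_le_self (by positivity)
      _ ≤ (b + ‖x‖) / b := by gcongr
      _ = 1 + ‖x‖ * b⁻¹ := by field_simp
      _ ≤ _ := by gcongr; exact inv_le_one_add_inv_sq b
  have h1 := key _ _ hy0 hxy0 (by
    have := norm_sub_le x (x - y); rw [sub_sub_cancel] at this; linarith)
  have h2 := key _ _ hxy0 hy0 (by have := norm_sub_le x y; linarith)
  rw [← inv_div, Real.log_inv] at h2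
  rw [abs_le]; constructor <;> nlinarith

lemma measurable_ofReal_inv_norm_sub_sq {E : Type*} [NormedAddCommGroup E]
    [MeasurableSpace E] [BorelSpace E] [SecondCountableTopology E] :
    Measurable fun p : E × E => ENNReal.ofReal (‖p.1 - p.2‖ ^ 2)⁻¹ := by
  fun_prop

lemma ofReal_inv_norm_sq_le {E : Type*} [NormedAddCommGroup E] (z : E) :
    ENNReal.ofReal (‖z‖ ^ 2)⁻¹ ≤
      (ball (0 : E) 1).indicator (fun w => ENNReal.ofReal (‖w‖ ^ 2)⁻¹) z + 1 := by
  by_cases hz : z ∈ ball (0 : E) 1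
  · rw [indicator_of_mem hz]; exact le_self_add
  · rw [indicator_of_notMem hz, zero_add, ← ENNReal.ofReal_one]
    apply ENNReal.ofReal_le_ofReal
    rw [mem_ball_zero_iff, not_lt] at hz
    exact inv_le_one_of_one_le₀ (one_le_pow₀ hz)

section InverseSquare

open scoped ENNReal

variable {E : Type*} [NormedAddCommGroup E] [InnerProductSpace ℝ E] [FiniteDimensional ℝ E]
  [MeasurableSpace E] [BorelSpace E]

lemma integrableOn_inv_norm_sq (hE : 3 ≤ Module.finrank ℝ E) :
    IntegrableOn (fun z : E => (‖z‖ ^ 2)⁻¹) (ball 0 1) := by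
  have : Nontrivial E := Module.nontrivial_of_finrank_pos (R := ℝ) (by omega)
  rw [integrableOn_fun_norm_addHaar volume (f := fun t : ℝ => (t ^ 2)⁻¹)]
  have hcont : IntegrableOn (fun t : ℝ => t ^ (Module.finrank ℝ E - 3)) (Ioo 0 1) :=
    ((continuous_pow _).integrableOn_Icc).mono_set Ioo_subset_Icc_self
  refine hcont.congr_fun (fun t ht => ?_) measurableSet_Ioo
  have ht0 : t ≠ 0 := ht.1.ne'
  obtain ⟨k, hk⟩ := Nat.exists_eq_add_of_le hE
  have h1 : Module.finrank ℝ E - 1 = k + 2 := by omega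
  have h2 : Module.finrank ℝ E - 3 = k := by omega
  simp only [h1, h2, smul_eq_mul, pow_add]
  field_simp

lemma lintegral_ball_inv_norm_sq_lt_top (hE : 3 ≤ Module.finrank ℝ E) :
    ∫⁻ z in ball (0 : E) 1, ENNReal.ofReal (‖z‖ ^ 2)⁻¹ < ∞ :=
  (hasFiniteIntegral_iff_ofReal (ae_of_all _ fun z => by positivity)).1
    (integrableOn_inv_norm_sq hE).2

/-- The potential of `|f|` with respect to the inverse square kernel. -/
noncomputable def invSqPotential (f : E → ℝ) (x : E) : ℝ≥0∞ :=
  ∫⁻ y, ENNReal.ofReal (‖x - y‖ ^ 2)⁻¹ * ‖f y‖ₑ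

lemma measurable_invSqPotential {f : E → ℝ} (hf : Measurable f) :
    Measurable (invSqPotential f) := by
  refine Measurable.lintegral_prod_right'
    (f := fun p : E × E => ENNReal.ofReal (‖p.1 - p.2‖ ^ 2)⁻¹ * ‖f p.2‖ₑ) ?_
  exact measurable_ofReal_inv_norm_sub_sq.mul (hf.comp measurable_snd).enorm

lemma exists_invSqPotential_le (hE : 3 ≤ Module.finrank ℝ E) {f : E → ℝ} (hf : Continuous f)
    (hfi : Integrable f) (x₀ : E) :
    ∃ C : ℝ≥0∞, C ≠ ∞ ∧ ∀ x ∈ ball x₀ 1, invSqPotential f x ≤ C := by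
  obtain ⟨M, hM⟩ := (isCompact_closedBall x₀ 2).exists_bound_of_continuousOn hf.continuousOn
  set J := ∫⁻ z in ball (0 : E) 1, ENNReal.ofReal (‖z‖ ^ 2)⁻¹
  have hJfin : J ≠ ∞ := (lintegral_ball_inv_norm_sq_lt_top hE).ne
  refine ⟨J * ENNReal.ofReal M + ∫⁻ y, ‖f y‖ₑ,
    ENNReal.add_ne_top.2 ⟨ENNReal.mul_ne_top hJfin ENNReal.ofReal_ne_top, hfi.2.ne⟩,
    fun x hx => ?_⟩
  set g : E → ℝ≥0∞ := (ball (0 : E) 1).indicator fun w => ENNReal.ofReal (‖w‖ ^ 2)⁻¹ with hg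
  have hgm : Measurable g := Measurable.indicator (by fun_prop) measurableSet_ball
  have hgJ : ∫⁻ y, g (x - y) = J := by
    rw [lintegral_sub_left_eq_self g x, hg, lintegral_indicator measurableSet_ball]
  calc invSqPotential f x
      ≤ ∫⁻ y, (g (x - y) * ENNReal.ofReal M + ‖f y‖ₑ) := by
        refine lintegral_mono fun y => ?_
        calc ENNReal.ofReal (‖x - y‖ ^ 2)⁻¹ * ‖f y‖ₑ ≤ (g (x - y) + 1) * ‖f y‖ₑ := by
              gcongr; exact ofReal_inv_norm_sq_le _
          _ = g (x - y) * ‖f y‖ₑ + ‖f y‖ₑ := by ring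
          _ ≤ _ := by
              gcongr ?_ + _
              by_cases hxy : x - y ∈ ball (0 : E) 1
              · gcongr
                rw [← ofReal_norm]
                apply ENNReal.ofReal_le_ofReal
                apply hM
                rw [mem_ball_zero_iff, ← dist_eq_norm] at hxy
                rw [mem_ball] at hx
                rw [mem_closedBall]
                linarith [dist_triangle_left y x₀ x]
              · simp [hg, indicator_of_notMem hxy]
    _ = _ := by
        rw [lintegral_add_right _ hf.measurable.enorm, lintegral_mul_const _ (by fun_prop), hgJ]

lemma integrable_inv_norm_sub_sq_mul (hE : 3 ≤ Module.finrank ℝ E) {f : E → ℝ}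
    (hf : Continuous f) (hfi : Integrable f) (x : E) :
    Integrable fun y => (‖x - y‖ ^ 2)⁻¹ * |f y| := by
  obtain ⟨C, hC, h⟩ := exists_invSqPotential_le hE hf hfi x
  refine ⟨by fun_prop, ?_⟩
  rw [hasFiniteIntegral_iff_enorm]
  refine lt_of_eq_of_lt ?_ ((h x (mem_ball_self one_pos)).trans_lt hC.lt_top)
  refine lintegral_congr fun y => ?_
  rw [enorm_mul, Real.enorm_of_nonneg (by positivity), enorm_abs]

lemma ofReal_integral_inv_norm_sub_sq_mul (hE : 3 ≤ Module.finrank ℝ E) {f : E → ℝ}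
    (hf : Continuous f) (hfi : Integrable f) (x : E) :
    ENNReal.ofReal (∫ y, (‖x - y‖ ^ 2)⁻¹ * |f y|) = invSqPotential f x := by
  rw [ofReal_integral_eq_lintegral_ofReal (integrable_inv_norm_sub_sq_mul hE hf hfi x)
    (ae_of_all _ fun y => by positivity)]
  refine lintegral_congr fun y => ?_
  rw [ENNReal.ofReal_mul (by positivity), ← Real.norm_eq_abs, ofReal_norm]

lemma tendsto_lintegral_ball_invSqPotential (hE : 3 ≤ Module.finrank ℝ E) {f : E → ℝ}
    (hf : Continuous f) (hfi : Integrable f) (r : ℝ) :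
    Tendsto (fun x₀ => ∫⁻ x in ball x₀ r, invSqPotential f x) (cocompact E) (𝓝 0) := by
  set J := ∫⁻ z in ball (0 : E) 1, ENNReal.ofReal (‖z‖ ^ 2)⁻¹
  have hJfin : J ≠ ∞ := (lintegral_ball_inv_norm_sq_lt_top hE).ne
  set V := volume (ball (0 : E) r)
  have hVfin : V ≠ ∞ := measure_ball_lt_top.ne
  have hVx : ∀ x₀ : E, volume (ball x₀ r) = V := fun x₀ =>
    Measure.addHaar_ball_center volume x₀ r
  have hk : ∀ y : E, Measurable fun x : E => ENNReal.ofReal (‖x - y‖ ^ 2)⁻¹ := fun y => by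
    fun_prop
  have hswap : ∀ x₀, ∫⁻ x in ball x₀ r, invSqPotential f x =
      ∫⁻ y, (∫⁻ x in ball x₀ r, ENNReal.ofReal (‖x - y‖ ^ 2)⁻¹) * ‖f y‖ₑ := by
    intro x₀
    simp only [invSqPotential]
    rw [lintegral_lintegral_swap]
    · exact lintegral_congr fun y => lintegral_mul_const _ (hk y)
    · exact (measurable_ofReal_inv_norm_sub_sq.mul
        (hf.measurable.comp measurable_snd).enorm).aemeasurable
  simp only [hswap]
  have hcg : (cocompact E).IsCountablyGenerated := by
    rw [← cobounded_eq_cocompact, ← comap_norm_atTop]; infer_instance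
  rw [← lintegral_zero (μ := (volume : Measure E))]
  refine tendsto_lintegral_filter_of_dominated_convergence (fun y => (J + V) * ‖f y‖ₑ)
    (Eventually.of_forall fun x₀ => ?_) (Eventually.of_forall fun x₀ => ae_of_all _ fun y => ?_)
    ?_ (ae_of_all _ fun y => ?_)
  · refine Measurable.mul ?_ hf.measurable.enorm
    exact Measurable.lintegral_prod_left' measurable_ofReal_inv_norm_sub_sq
  · gcongr
    calc ∫⁻ x in ball x₀ r, ENNReal.ofReal (‖x - y‖ ^ 2)⁻¹
        ≤ ∫⁻ x in ball x₀ r,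
          ((ball (0 : E) 1).indicator (fun w => ENNReal.ofReal (‖w‖ ^ 2)⁻¹) (x - y) + 1) :=
          lintegral_mono fun x => ofReal_inv_norm_sq_le _
      _ = (∫⁻ x in ball x₀ r,
          (ball (0 : E) 1).indicator (fun w => ENNReal.ofReal (‖w‖ ^ 2)⁻¹) (x - y)) + V := by
          rw [lintegral_add_right _ measurable_const, setLIntegral_one, hVx]
      _ ≤ (∫⁻ x,
          (ball (0 : E) 1).indicator (fun w => ENNReal.ofReal (‖w‖ ^ 2)⁻¹) (x - y)) + V := by
          gcongr ?_ + _; exact setLIntegral_le_lintegral _ _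
      _ = J + V := by
          rw [lintegral_sub_right_eq_self
            ((ball (0 : E) 1).indicator (fun w => ENNReal.ofReal (‖w‖ ^ 2)⁻¹)) y,
            lintegral_indicator measurableSet_ball]
  · rw [lintegral_const_mul _ hf.measurable.enorm]
    exact ENNReal.mul_ne_top (ENNReal.add_ne_top.2 ⟨hJfin, hVfin⟩) hfi.2.ne
  · have hlim : Tendsto (fun x₀ : E => ENNReal.ofReal (((‖x₀‖ - r - ‖y‖) ^ 2)⁻¹) * V)
        (cocompact E) (𝓝 0) := by
      have h1 : Tendsto (fun x₀ : E => ‖x₀‖ - r - ‖y‖) (cocompact E) atTop := by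
        simp only [sub_eq_add_neg]
        exact tendsto_atTop_add_const_right _ _
          (tendsto_atTop_add_const_right _ _ (tendsto_norm_cocompact_atTop (E := E)))
      have h2 := ENNReal.tendsto_ofReal
        (((tendsto_pow_atTop (α := ℝ) two_ne_zero).comp h1).inv_tendsto_atTop)
      rw [ENNReal.ofReal_zero] at h2
      simpa using ENNReal.Tendsto.mul_const h2 (Or.inr hVfin)
    have hle : ∀ᶠ x₀ in cocompact E, ∫⁻ x in ball x₀ r, ENNReal.ofReal (‖x - y‖ ^ 2)⁻¹ ≤
        ENNReal.ofReal (((‖x₀‖ - r - ‖y‖) ^ 2)⁻¹) * V := by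
      filter_upwards [(tendsto_norm_cocompact_atTop (E := E)).eventually_gt_atTop (r + ‖y‖)]
        with x₀ hx₀
      rw [← hVx x₀, ← setLIntegral_const]
      refine setLIntegral_mono measurable_const fun x hx => ?_
      apply ENNReal.ofReal_le_ofReal
      have h0 : 0 < ‖x₀‖ - r - ‖y‖ := by linarith
      have h1 : ‖x₀‖ - r - ‖y‖ ≤ ‖x - y‖ := by
        rw [mem_ball_iff_norm] at hx
        have := norm_sub_le x₀ (x₀ - x)
        have h3 := norm_sub_norm_le x y
        have h4 := norm_sub_norm_le x₀ x
        rw [norm_sub_rev] at hx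
        linarith
      gcongr
    have := tendsto_of_tendsto_of_tendsto_of_le_of_le' tendsto_const_nhds hlim
      (Eventually.of_forall fun _ => zero_le) hle
    simpa using ENNReal.Tendsto.mul_const this (Or.inr (enorm_ne_top (x := f y)))

end InverseSquare

section LogPotential

open scoped ENNReal

variable {E : Type*} [NormedAddCommGroup E] [InnerProductSpace ℝ E] [FiniteDimensional ℝ E]
  [MeasurableSpace E] [BorelSpace E]

/-- The logarithmic potential of `f`, normalized at the origin. -/
noncomputable def logPotential (f : E → ℝ) (x : E) : ℝ :=
  ∫ y, Real.log (‖y‖ / ‖x - y‖) * f y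

/-- The gradient of the logarithmic potential of `f`. -/
noncomputable def logPotentialGrad (f : E → ℝ) (x : E) : E :=
  -∫ y, ((‖x - y‖ ^ 2)⁻¹ * f y) • (x - y)

lemma integrable_log_norm_div_mul (hE : 3 ≤ Module.finrank ℝ E) {f : E → ℝ}
    (hf : Continuous f) (hfi : Integrable f) (x : E) :
    Integrable fun y => Real.log (‖y‖ / ‖x - y‖) * f y := by
  have h0 := integrable_inv_norm_sub_sq_mul hE hf hfi 0
  simp only [zero_sub, norm_neg] at h0
  refine Integrable.mono' ((((hfi.abs.const_mul (1 + 2 * ‖x‖)).add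
    ((integrable_inv_norm_sub_sq_mul hE hf hfi x).const_mul ‖x‖))).add (h0.const_mul ‖x‖))
    ?_ (ae_of_all _ fun y => ?_)
  · have : Measurable fun y => Real.log (‖y‖ / ‖x - y‖) * f y :=
      (Real.measurable_log.comp (by fun_prop)).mul hf.measurable
    exact this.aestronglyMeasurable
  · have := mul_le_mul_of_nonneg_right (abs_log_norm_div_norm_le x y) (abs_nonneg (f y))
    rw [Real.norm_eq_abs, abs_mul]
    simp only [Pi.add_apply]
    linarith

lemma integrable_inv_norm_sub_sq_mul_smul (hE : 3 ≤ Module.finrank ℝ E) {f : E → ℝ}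
    (hf : Continuous f) (hfi : Integrable f) (x : E) :
    Integrable fun y => ((‖x - y‖ ^ 2)⁻¹ * f y) • (x - y) := by
  refine Integrable.mono' (hfi.abs.add (integrable_inv_norm_sub_sq_mul hE hf hfi x))
    ?_ (ae_of_all _ fun y => ?_)
  · have : Measurable fun y => ((‖x - y‖ ^ 2)⁻¹ * f y) • (x - y) := by fun_prop
    exact this.aestronglyMeasurable
  · have h1 : ‖((‖x - y‖ ^ 2)⁻¹ * f y) • (x - y)‖ = ‖x - y‖⁻¹ * |f y| := by
      rw [norm_smul, norm_mul, norm_inv, norm_pow, norm_norm, Real.norm_eq_abs]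
      by_cases h : ‖x - y‖ = 0
      · simp [h]
      · field_simp
    rw [h1]
    simp only [Pi.add_apply]
    calc _ ≤ (1 + (‖x - y‖ ^ 2)⁻¹) * |f y| := by gcongr; exact inv_le_one_add_inv_sq _
      _ = _ := by ring

lemma integrable_inner_div_mul (hE : 3 ≤ Module.finrank ℝ E) {f : E → ℝ}
    (hf : Continuous f) (hfi : Integrable f) (x v : E) :
    Integrable fun y => inner ℝ (x - y) v / ‖x - y‖ ^ 2 * f y := by
  refine ((integrable_inv_norm_sub_sq_mul_smul hE hf hfi x).inner_const (𝕜 := ℝ) v).congr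
    (ae_of_all _ fun y => ?_)
  simp only [real_inner_smul_left]
  ring

lemma inner_logPotentialGrad (hE : 3 ≤ Module.finrank ℝ E) {f : E → ℝ}
    (hf : Continuous f) (hfi : Integrable f) (x v : E) :
    inner ℝ (logPotentialGrad f x) v = -∫ y, inner ℝ (x - y) v / ‖x - y‖ ^ 2 * f y := by
  rw [logPotentialGrad, inner_neg_left, real_inner_comm,
    ← integral_inner (integrable_inv_norm_sub_sq_mul_smul hE hf hfi x) v]
  congr 2 with y
  rw [real_inner_smul_right, real_inner_comm]
  ring

lemma abs_integral_mul_le (hE : 3 ≤ Module.finrank ℝ E) {f : E → ℝ} (hf : Continuous f)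
    (hfi : Integrable f) (x v : E) {c : ℝ} {g : E → ℝ}
    (hg : ∀ᵐ y, |g y| ≤ c * ((‖x - y‖ ^ 2)⁻¹ + (‖x + v - y‖ ^ 2)⁻¹)) :
    |∫ y, g y * f y| ≤
      c * ((∫ y, (‖x - y‖ ^ 2)⁻¹ * |f y|) + ∫ y, (‖x + v - y‖ ^ 2)⁻¹ * |f y|) := by
  have h1 := integrable_inv_norm_sub_sq_mul hE hf hfi x
  have h2 := integrable_inv_norm_sub_sq_mul hE hf hfi (x + v)
  rw [← integral_add h1 h2, ← integral_const_mul, ← Real.norm_eq_abs]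
  refine norm_integral_le_of_norm_le ((h1.add h2).const_mul c) ?_
  filter_upwards [hg] with y hy
  rw [Real.norm_eq_abs, abs_mul]
  have := mul_le_mul_of_nonneg_right hy (abs_nonneg (f y))
  linarith

lemma abs_logPotential_add_sub_le (hE : 3 ≤ Module.finrank ℝ E) {f : E → ℝ}
    (hf : Continuous f) (hfi : Integrable f) (x v : E) :
    |logPotential f (x + v) - logPotential f x - inner ℝ (logPotentialGrad f x) v| ≤
      2 * ‖v‖ ^ 2 *
        ((∫ y, (‖x - y‖ ^ 2)⁻¹ * |f y|) + ∫ y, (‖x + v - y‖ ^ 2)⁻¹ * |f y|) := by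
  have : Nontrivial E := Module.nontrivial_of_finrank_pos (R := ℝ) (by omega)
  have h1 := integrable_log_norm_div_mul hE hf hfi x
  have h2 := integrable_log_norm_div_mul hE hf hfi (x + v)
  have h3 := integrable_inner_div_mul hE hf hfi x v
  rw [inner_logPotentialGrad hE hf hfi, logPotential, logPotential, sub_neg_eq_add,
    ← integral_sub h2 h1]
  have h4 := integral_add (h2.sub h1) h3
  simp only [Pi.sub_apply] at h4
  rw [← h4]
  have heq : (fun y => Real.log (‖y‖ / ‖x + v - y‖) * f y - Real.log (‖y‖ / ‖x - y‖) * f y +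
      inner ℝ (x - y) v / ‖x - y‖ ^ 2 * f y) = fun y =>
      (Real.log (‖y‖ / ‖x + v - y‖) - Real.log (‖y‖ / ‖x - y‖) +
        inner ℝ (x - y) v / ‖x - y‖ ^ 2) * f y := by ext y; ring
  rw [heq]
  refine abs_integral_mul_le hE hf hfi x v ?_
  filter_upwards [Measure.ae_ne volume (0 : E), Measure.ae_ne volume x,
    Measure.ae_ne volume (x + v)] with y hy0 hyx hyv
  have hx : x - y ≠ 0 := sub_ne_zero.2 hyx.symm
  have hxv' : x + v - y ≠ 0 := sub_ne_zero.2 hyv.symm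
  have hadd : x + v - y = x - y + v := by abel
  rw [hadd] at hxv' ⊢
  have h := abs_log_norm_add_sub_le hx hxv'
  rw [Real.log_div (norm_ne_zero_iff.2 hy0) (norm_ne_zero_iff.2 hx),
    Real.log_div (norm_ne_zero_iff.2 hy0) (norm_ne_zero_iff.2 hxv'), ← abs_neg]
  convert h using 2
  ring

lemma abs_inner_logPotentialGrad_sub_le (hE : 3 ≤ Module.finrank ℝ E) {f : E → ℝ}
    (hf : Continuous f) (hfi : Integrable f) (x v e : E) :
    |inner ℝ (logPotentialGrad f (x + v)) e - inner ℝ (logPotentialGrad f x) e| ≤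
      ‖v‖ * ‖e‖ *
        ((∫ y, (‖x - y‖ ^ 2)⁻¹ * |f y|) + ∫ y, (‖x + v - y‖ ^ 2)⁻¹ * |f y|) := by
  have : Nontrivial E := Module.nontrivial_of_finrank_pos (R := ℝ) (by omega)
  have h1 := integrable_inner_div_mul hE hf hfi x e
  have h2 := integrable_inner_div_mul hE hf hfi (x + v) e
  rw [inner_logPotentialGrad hE hf hfi, inner_logPotentialGrad hE hf hfi, neg_sub_neg,
    abs_sub_comm, ← integral_sub h2 h1]
  simp only [← sub_mul]
  refine abs_integral_mul_le hE hf hfi x v ?_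
  filter_upwards [Measure.ae_ne volume x, Measure.ae_ne volume (x + v)] with y hyx hyv
  have hx : x - y ≠ 0 := sub_ne_zero.2 hyx.symm
  have hxv' : x + v - y ≠ 0 := sub_ne_zero.2 hyv.symm
  have hadd : x + v - y = x - y + v := by abel
  rw [hadd] at hxv' ⊢
  exact abs_inner_div_norm_sq_sub_le e hx hxv'

lemma hasFDerivAt_logPotential (hE : 3 ≤ Module.finrank ℝ E) {f : E → ℝ}
    (hf : Continuous f) (hfi : Integrable f) (x : E) :
    HasFDerivAt (logPotential f) (innerSL ℝ (logPotentialGrad f x)) x := by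
  obtain ⟨C, hC, h⟩ := exists_invSqPotential_le hE hf hfi x
  have hle : ∀ z ∈ ball x 1, ∫ y, (‖z - y‖ ^ 2)⁻¹ * |f y| ≤ C.toReal := fun z hz => by
    rw [← ENNReal.ofReal_le_iff_le_toReal hC, ofReal_integral_inv_norm_sub_sq_mul hE hf hfi]
    exact h z hz
  rw [hasFDerivAt_iff_isLittleO_nhds_zero]
  have hO : (fun v => logPotential f (x + v) - logPotential f x -
      innerSL ℝ (logPotentialGrad f x) v) =O[𝓝 0] fun v => ‖v‖ ^ 2 := by
    refine Asymptotics.IsBigO.of_bound (4 * C.toReal) ?_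
    filter_upwards [ball_mem_nhds (0 : E) one_pos] with v hv
    rw [mem_ball_zero_iff] at hv
    rw [innerSL_apply_apply, Real.norm_eq_abs, norm_pow, norm_norm]
    refine (abs_logPotential_add_sub_le hE hf hfi x v).trans ?_
    have h1 := hle x (mem_ball_self one_pos)
    have h2 := hle (x + v) (by simpa using hv)
    nlinarith [sq_nonneg ‖v‖]
  exact hO.trans_isLittleO (Asymptotics.isLittleO_norm_pow_id one_lt_two)

lemma ofReal_abs_iteratedFDeriv_two_logPotential_le (hE : 3 ≤ Module.finrank ℝ E) {f : E → ℝ}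
    (hf : Continuous f) (hfi : Integrable f) (x : E) {e : E} (he : ‖e‖ = 1) :
    ENNReal.ofReal |iteratedFDeriv ℝ 2 (logPotential f) x fun _ => e| ≤
      liminf (fun k : ℕ => invSqPotential f x + invSqPotential f (x + (k : ℝ)⁻¹ • e)) atTop := by
  have hfd : fderiv ℝ (logPotential f) = fun z => innerSL ℝ (logPotentialGrad f z) :=
    funext fun z => (hasFDerivAt_logPotential hE hf hfi z).fderiv
  rw [iteratedFDeriv_two_apply]
  by_cases hd : DifferentiableAt ℝ (fderiv ℝ (logPotential f)) x
  swap
  · simp [fderiv_zero_of_not_differentiableAt hd]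
  have hlim := (hd.hasFDerivAt.lim_real e).comp (tendsto_natCast_atTop_atTop (R := ℝ))
  have hlim2 := ENNReal.tendsto_ofReal
    (((ContinuousLinearMap.apply ℝ ℝ e).continuous.tendsto _).comp hlim).abs
  rw [show ENNReal.ofReal |fderiv ℝ (fderiv ℝ (logPotential f)) x e e| = _ from
    hlim2.liminf_eq.symm]
  refine liminf_le_liminf (Eventually.of_forall fun k => ?_)
  rw [← ofReal_integral_inv_norm_sub_sq_mul hE hf hfi,
    ← ofReal_integral_inv_norm_sub_sq_mul hE hf hfi, ← ENNReal.ofReal_add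
      (integral_nonneg fun y => by positivity) (integral_nonneg fun y => by positivity)]
  apply ENNReal.ofReal_le_ofReal
  have h := abs_inner_logPotentialGrad_sub_le hE hf hfi x ((k : ℝ)⁻¹ • e) e
  simp only [Function.comp_apply, hfd, ContinuousLinearMap.apply_apply,
    _root_.smul_apply, _root_.sub_apply, innerSL_apply_apply,
    smul_eq_mul, abs_mul, Nat.abs_cast]
  calc _ ≤ (k : ℝ) * _ := mul_le_mul_of_nonneg_left h k.cast_nonneg
    _ = ((k : ℝ) * (k : ℝ)⁻¹) * ((∫ y, (‖x - y‖ ^ 2)⁻¹ * |f y|) +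
        ∫ y, (‖x + (k : ℝ)⁻¹ • e - y‖ ^ 2)⁻¹ * |f y|) := by
      rw [norm_smul, he, norm_inv, Real.norm_natCast]; ring
    _ ≤ _ := mul_le_of_le_one_left (add_nonneg (integral_nonneg fun y => by positivity)
        (integral_nonneg fun y => by positivity)) mul_inv_le_one

lemma lintegral_ball_iteratedFDeriv_two_logPotential_le (hE : 3 ≤ Module.finrank ℝ E)
    {f : E → ℝ} (hf : Continuous f) (hfi : Integrable f) (x₀ : E) {e : E} (he : ‖e‖ = 1) :
    ∫⁻ x in ball x₀ 1, ENNReal.ofReal |iteratedFDeriv ℝ 2 (logPotential f) x fun _ => e| ≤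
      2 * ∫⁻ x in ball x₀ 2, invSqPotential f x := by
  have hm := measurable_invSqPotential hf.measurable
  have hshift : ∀ a : E, ‖a‖ ≤ 1 → ∫⁻ x in ball x₀ 1, invSqPotential f (x + a) ≤
      ∫⁻ x in ball x₀ 2, invSqPotential f x := by
    intro a ha
    rw [← lintegral_indicator measurableSet_ball, ← lintegral_indicator measurableSet_ball,
      ← lintegral_add_right_eq_self ((ball x₀ 2).indicator (invSqPotential f)) a]
    refine lintegral_mono fun x => ?_
    by_cases hx : x ∈ ball x₀ 1
    · have hxa : x + a ∈ ball x₀ 2 := by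
        rw [mem_ball_iff_norm] at hx ⊢
        have := norm_add_le (x - x₀) a
        rw [show x + a - x₀ = x - x₀ + a by abel]
        linarith
      rw [indicator_of_mem hx, indicator_of_mem hxa]
    · simp [indicator_of_notMem hx]
  calc _ ≤ ∫⁻ x in ball x₀ 1, liminf (fun k : ℕ =>
          invSqPotential f x + invSqPotential f (x + (k : ℝ)⁻¹ • e)) atTop :=
        lintegral_mono fun x => ofReal_abs_iteratedFDeriv_two_logPotential_le hE hf hfi x he
    _ ≤ liminf (fun k : ℕ => ∫⁻ x in ball x₀ 1,
          (invSqPotential f x + invSqPotential f (x + (k : ℝ)⁻¹ • e))) atTop :=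
        lintegral_liminf_le fun k => hm.add (hm.comp (measurable_add_const _))
    _ ≤ liminf (fun _ : ℕ => 2 * ∫⁻ x in ball x₀ 2, invSqPotential f x) atTop := by
        refine liminf_le_liminf (Eventually.of_forall fun k => ?_)
        rw [lintegral_add_left hm, two_mul]
        gcongr ?_ + ?_
        · simpa using hshift 0 (by simp)
        · refine hshift _ ?_
          rw [norm_smul, he, norm_inv, Real.norm_natCast, mul_one]
          exact Nat.cast_inv_le_one k
    _ = _ := liminf_const _

end LogPotential

lemma lintegral_ball_lap_logPotential_le {n : ℕ} (hn : 3 ≤ n)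
    {f : EuclideanSpace ℝ (Fin n) → ℝ} (hf : Continuous f) (hfi : Integrable f)
    (x₀ : EuclideanSpace ℝ (Fin n)) :
    ∫⁻ x in ball x₀ 1, ENNReal.ofReal |lap (logPotential f) x| ≤
      n * (2 * ∫⁻ x in ball x₀ 2, invSqPotential f x) := by
  have hE : 3 ≤ Module.finrank ℝ (EuclideanSpace ℝ (Fin n)) := by simpa using hn
  calc _ ≤ ∫⁻ x in ball x₀ 1, ∑ i : Fin n, ENNReal.ofReal
          |iteratedFDeriv ℝ 2 (logPotential f) x fun _ => EuclideanSpace.single i 1| := by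
        refine lintegral_mono fun x => ?_
        rw [← ENNReal.ofReal_sum_of_nonneg fun i _ => abs_nonneg _]
        exact ENNReal.ofReal_le_ofReal (Finset.abs_sum_le_sum_abs _ _)
    _ = ∑ i : Fin n, ∫⁻ x in ball x₀ 1, ENNReal.ofReal
          |iteratedFDeriv ℝ 2 (logPotential f) x fun _ => EuclideanSpace.single i 1| := by
        refine lintegral_finsetSum _ fun i _ => ?_
        simp only [iteratedFDeriv_two_apply]
        exact ((measurable_fderiv_apply_const ℝ _ _).apply_continuousLinearMap
          _).abs.ennreal_ofReal
    _ ≤ ∑ _i : Fin n, 2 * ∫⁻ x in ball x₀ 2, invSqPotential f x :=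
        Finset.sum_le_sum fun i _ =>
          lintegral_ball_iteratedFDeriv_two_logPotential_le hE hf hfi x₀ (by simp)
    _ = _ := by simp

/-- For `n ≥ 4` even, `f ∈ L¹(ℝⁿ)` continuous, and
`ũ(x) = (α_n/ω_n) ∫ log(|y|/|x−y|) f(y) dy` with `α_n > 0` the constant for which
`(−Δ)^{n/2} ũ = f`, the integrals `∫_{B₁(x₀)} |Δũ| dx` tend to `0` as `|x₀| → ∞`;
in particular `|∫_{B₁(x₀)} Δũ dx| → 0`. -/
theorem laplacian_of_log_potential_decays (n : ℕ) (hn4 : 4 ≤ n) (hne : Even n)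
    (f : EuclideanSpace ℝ (Fin n) → ℝ) (hfc : Continuous f) (hfint : Integrable f)
    (αn : ℝ) (hαn : 0 < αn)
    (utld : EuclideanSpace ℝ (Fin n) → ℝ)
    (hdef : ∀ x : EuclideanSpace ℝ (Fin n),
      utld x = (αn / sphereVol n) * ∫ y, Real.log (‖y‖ / ‖x - y‖) * f y)
    (hfund : ∀ x : EuclideanSpace ℝ (Fin n), negLapIter (n / 2) utld x = f x) :
    Filter.Tendsto (fun x₀ : EuclideanSpace ℝ (Fin n) => ∫ x in ball x₀ 1, |lap utld x|)
      (Filter.cocompact _) (nhds 0) ∧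
    Filter.Tendsto (fun x₀ : EuclideanSpace ℝ (Fin n) => |∫ x in ball x₀ 1, lap utld x|)
      (Filter.cocompact _) (nhds 0) := by
  have hE : 3 ≤ Module.finrank ℝ (EuclideanSpace ℝ (Fin n)) := by
    rw [finrank_euclideanSpace_fin]; omega
  set g : EuclideanSpace ℝ (Fin n) → ℝ := fun y => αn / sphereVol n * f y with hg
  have hgc : Continuous g := hfc.const_mul _
  have hgi : Integrable g := hfint.const_mul _
  have hu : utld = logPotential g := by
    ext x
    rw [hdef, logPotential, ← integral_const_mul]
    congr 1 with y
    rw [hg]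
    ring
  subst hu
  have hlim : Tendsto (fun x₀ => (∫⁻ x in ball x₀ 1,
      ENNReal.ofReal |lap (logPotential g) x|).toReal) (cocompact _) (𝓝 0) := by
    have h := ENNReal.Tendsto.const_mul (a := n) (ENNReal.Tendsto.const_mul (a := 2)
      (tendsto_lintegral_ball_invSqPotential hE hgc hgi 2) (Or.inr ENNReal.ofNat_ne_top))
      (Or.inr (ENNReal.natCast_ne_top n))
    simp only [mul_zero] at h
    have h' := tendsto_of_tendsto_of_tendsto_of_le_of_le tendsto_const_nhds h
      (fun _ => zero_le) (lintegral_ball_lap_logPotential_le (by omega) hgc hgi)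
    exact (ENNReal.tendsto_toReal ENNReal.zero_ne_top).comp h'
  refine ⟨squeeze_zero (fun x₀ => integral_nonneg fun x => abs_nonneg _) (fun x₀ => ?_) hlim,
    squeeze_zero (fun x₀ => abs_nonneg _) (fun x₀ => ?_) hlim⟩
  · refine (le_abs_self _).trans ?_
    simpa using norm_integral_le_lintegral_norm (μ := volume.restrict (ball x₀ 1))
      fun x => |lap (logPotential g) x|
  · exact norm_integral_le_lintegral_norm (μ := volume.restrict (ball x₀ 1))
      fun x => lap (logPotential g) x
end

section
/- Let n ≥ 4 be an even integer and let v : ℝ^n → ℝ be smooth with Δ^{n/2} v = 0 on ℝ^n. Suppose there is a constant C such that for every x₀ ∈ ℝ^n and all sufficiently large R (depending on x₀), the ball averages satisfy (1/|B_R(x₀)|) ∫_{B_R(x₀)} v⁺(y) dy ≤ C log(2R + 2), where v⁺ = max(v, 0). Then all derivatives of v of order n − 1 vanish identically; in particular, v is a polynomial of degree at most n − 2. -/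
open MeasureTheory Metric Real MvPolynomial

/-- The `m`-fold iterate `Δ^m u` of the Laplacian. -/
noncomputable def lapIter {n : ℕ} (m : ℕ) (u : EuclideanSpace ℝ (Fin n) → ℝ) :
    EuclideanSpace ℝ (Fin n) → ℝ :=
  (fun v x => lap v x)^[m] u

/-- Evaluation of a real polynomial in `n` variables at a point of `ℝⁿ`. -/
noncomputable def evalPoly {n : ℕ} (p : MvPolynomial (Fin n) ℝ)
    (x : EuclideanSpace ℝ (Fin n)) : ℝ :=
  MvPolynomial.eval (fun i => x i) p

/-- The directional derivative of `f` in the direction `e`. -/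
noncomputable def dirDeriv {E : Type*} [NormedAddCommGroup E] [NormedSpace ℝ E] (e : E)
    (f : E → ℝ) (x : E) : ℝ :=
  fderiv ℝ f x e

/-- The iterated directional derivative of `f` along the directions in the list `L`. -/
noncomputable def iterDirDeriv {E : Type*} [NormedAddCommGroup E] [NormedSpace ℝ E] (L : List E)
    (f : E → ℝ) : E → ℝ :=
  L.foldr dirDeriv f

section DirectionalDerivatives

variable {E : Type*} [NormedAddCommGroup E] [NormedSpace ℝ E]

theorem ContDiff.dirDeriv {f : E → ℝ} (hf : ContDiff ℝ (⊤ : ℕ∞) f) (e : E) :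
    ContDiff ℝ (⊤ : ℕ∞) (dirDeriv e f) :=
  (hf.fderiv_right (m := (⊤ : ℕ∞)) (by simp)).clm_apply contDiff_const

theorem ContDiff.iterDirDeriv {f : E → ℝ} (hf : ContDiff ℝ (⊤ : ℕ∞) f) (L : List E) :
    ContDiff ℝ (⊤ : ℕ∞) (iterDirDeriv L f) := by
  induction L with
  | nil => exact hf
  | cons e L ih => exact ih.dirDeriv e

theorem ContDiff.differentiable_of_smooth {f : E → ℝ} (hf : ContDiff ℝ (⊤ : ℕ∞) f) :
    Differentiable ℝ f :=
  hf.differentiable (by simp)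

theorem dirDeriv_dirDeriv {f : E → ℝ} (hf : ContDiff ℝ (⊤ : ℕ∞) f) (a b x : E) :
    dirDeriv a (dirDeriv b f) x = fderiv ℝ (fderiv ℝ f) x a b := by
  have h : DifferentiableAt ℝ (fderiv ℝ f) x :=
    ((hf.fderiv_right (m := (⊤ : ℕ∞)) (by simp)).differentiable (by simp)) x
  have := (h.hasFDerivAt.clm_apply (hasFDerivAt_const b x)).fderiv
  change fderiv ℝ (fun y => fderiv ℝ f y b) x a = _
  rw [this]
  simp

theorem dirDeriv_comm {f : E → ℝ} (hf : ContDiff ℝ (⊤ : ℕ∞) f) (a b : E) :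
    dirDeriv a (dirDeriv b f) = dirDeriv b (dirDeriv a f) := by
  ext x
  rw [dirDeriv_dirDeriv hf, dirDeriv_dirDeriv hf]
  exact hf.contDiffAt.isSymmSndFDerivAt
    (by simpa using WithTop.coe_le_coe.2 (le_top : (2 : ℕ∞) ≤ ⊤)) a b

theorem dirDeriv_sum {ι : Type*} (s : Finset ι) {f : ι → E → ℝ}
    (hf : ∀ i, ContDiff ℝ (⊤ : ℕ∞) (f i)) (e : E) :
    dirDeriv e (fun x => ∑ i ∈ s, f i x) = fun x => ∑ i ∈ s, dirDeriv e (f i) x := by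
  ext x
  simp only [dirDeriv]
  rw [fderiv_fun_sum fun i _ => (hf i).differentiable_of_smooth x]
  simp

theorem dirDeriv_comp_add_smul {f : E → ℝ} (hf : ContDiff ℝ (⊤ : ℕ∞) f) (e x : E) (r : ℝ) (y : E) :
    dirDeriv e (fun y => f (x + r • y)) y = r * dirDeriv e f (x + r • y) := by
  have h1 : HasFDerivAt (fun y : E => x + r • y) (r • ContinuousLinearMap.id ℝ E) y :=
    ((hasFDerivAt_id y).const_smul r).const_add x
  have := ((hf.differentiable_of_smooth (x + r • y)).hasFDerivAt.comp y h1).fderiv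
  simp only [dirDeriv]
  rw [show (fun y => f (x + r • y)) = f ∘ fun y => x + r • y from rfl, this]
  simp

theorem hasDerivAt_comp_add_smul {f : E → ℝ} (hf : ContDiff ℝ (⊤ : ℕ∞) f) (x y : E) (r : ℝ) :
    HasDerivAt (fun r : ℝ => f (x + r • y)) (dirDeriv y f (x + r • y)) r := by
  have h1 : HasDerivAt (fun r : ℝ => x + r • y) y r := by
    simpa using ((hasDerivAt_id r).smul_const y).const_add x
  exact (hf.differentiable_of_smooth (x + r • y)).hasFDerivAt.comp_hasDerivAt r h1

theorem iteratedFDeriv_apply_eq_iterDirDeriv {f : E → ℝ} (hf : ContDiff ℝ (⊤ : ℕ∞) f) (k : ℕ)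
    (m : Fin k → E) (x : E) :
    iteratedFDeriv ℝ k f x m = iterDirDeriv (List.ofFn m) f x := by
  induction k generalizing x with
  | zero => simp [iterDirDeriv]
  | succ k ih =>
    have hd : DifferentiableAt ℝ (iteratedFDeriv ℝ k f) x :=
      (hf.differentiable_iteratedFDeriv (m := k) (by exact_mod_cast ENat.natCast_lt_top k)) x
    rw [iteratedFDeriv_succ_apply_left, List.ofFn_succ]
    change _ = fderiv ℝ (iterDirDeriv (List.ofFn fun i : Fin k => m i.succ) f) x (m 0)
    rw [← funext (ih fun i => m i.succ)]
    have := (hd.hasFDerivAt.continuousMultilinear_apply_const (fun i : Fin k => m i.succ)).fderiv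
    rw [this]
    rfl

theorem HasCompactSupport.dirDeriv {f : E → ℝ} (hf : HasCompactSupport f) (e : E) :
    HasCompactSupport (dirDeriv e f) :=
  hf.fderiv_apply ℝ e

theorem HasCompactSupport.iterDirDeriv {f : E → ℝ} (hf : HasCompactSupport f) (L : List E) :
    HasCompactSupport (iterDirDeriv L f) := by
  induction L with
  | nil => exact hf
  | cons e L ih => exact ih.dirDeriv e

theorem tsupport_iterDirDeriv_subset (f : E → ℝ) (L : List E) :
    tsupport (iterDirDeriv L f) ⊆ tsupport f := by
  induction L with
  | nil => exact subset_rfl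
  | cons e L ih => exact (tsupport_fderiv_apply_subset ℝ e).trans ih

end DirectionalDerivatives

section Laplacian

variable {n : ℕ}

theorem lap_eq_sum_dirDeriv {f : EuclideanSpace ℝ (Fin n) → ℝ} (hf : ContDiff ℝ (⊤ : ℕ∞) f) :
    lap f = fun x => ∑ i, dirDeriv (EuclideanSpace.single i 1)
      (dirDeriv (EuclideanSpace.single i 1) f) x := by
  ext x
  simp only [lap, iteratedFDeriv_two_apply, dirDeriv_dirDeriv hf]

theorem ContDiff.lap {f : EuclideanSpace ℝ (Fin n) → ℝ} (hf : ContDiff ℝ (⊤ : ℕ∞) f) :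
    ContDiff ℝ (⊤ : ℕ∞) (lap f) := by
  rw [lap_eq_sum_dirDeriv hf]
  exact ContDiff.sum fun i _ => (hf.dirDeriv _).dirDeriv _

theorem lap_dirDeriv {f : EuclideanSpace ℝ (Fin n) → ℝ} (hf : ContDiff ℝ (⊤ : ℕ∞) f)
    (e : EuclideanSpace ℝ (Fin n)) : lap (dirDeriv e f) = dirDeriv e (lap f) := by
  rw [lap_eq_sum_dirDeriv hf, lap_eq_sum_dirDeriv (hf.dirDeriv e),
    dirDeriv_sum _ fun i => (hf.dirDeriv _).dirDeriv _]
  ext x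
  refine Finset.sum_congr rfl fun i _ => ?_
  rw [dirDeriv_comm hf, dirDeriv_comm (hf.dirDeriv _)]

theorem lapIter_succ (m : ℕ) (f : EuclideanSpace ℝ (Fin n) → ℝ) :
    lapIter (m + 1) f = lapIter m (lap f) := rfl

theorem lapIter_dirDeriv (m : ℕ) {f : EuclideanSpace ℝ (Fin n) → ℝ} (hf : ContDiff ℝ (⊤ : ℕ∞) f)
    (e : EuclideanSpace ℝ (Fin n)) : lapIter m (dirDeriv e f) = dirDeriv e (lapIter m f) := by
  induction m generalizing f with
  | zero => rfl
  | succ m ih => rw [lapIter_succ, lapIter_succ, lap_dirDeriv hf, ih hf.lap]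

theorem lapIter_iterDirDeriv_eq_zero {m : ℕ} {f : EuclideanSpace ℝ (Fin n) → ℝ}
    (hf : ContDiff ℝ (⊤ : ℕ∞) f) (h : lapIter m f = 0) (L : List (EuclideanSpace ℝ (Fin n))) :
    lapIter m (iterDirDeriv L f) = 0 := by
  induction L with
  | nil => exact h
  | cons e L ih =>
    change lapIter m (dirDeriv e (iterDirDeriv L f)) = 0
    rw [lapIter_dirDeriv m (hf.iterDirDeriv L), ih]
    ext x
    simp [dirDeriv]

end Laplacian
section Kernels

variable {n : ℕ}

theorem integrable_mul_of_hasCompactSupport {k h : EuclideanSpace ℝ (Fin n) → ℝ}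
    (hk : Continuous k) (hkc : HasCompactSupport k) (hh : Continuous h) :
    Integrable fun y => k y * h y :=
  (hk.mul hh).integrable_of_hasCompactSupport hkc.mul_right

theorem hasDerivAt_integral_kernel {k f : EuclideanSpace ℝ (Fin n) → ℝ} (hk : Continuous k)
    (hkc : HasCompactSupport k) (hf : ContDiff ℝ (⊤ : ℕ∞) f) (x : EuclideanSpace ℝ (Fin n))
    (r : ℝ) :
    HasDerivAt (fun r : ℝ => ∫ y, k y * f (x + r • y))
      (∫ y, k y * dirDeriv y f (x + r • y)) r := by
  have hdc : Continuous fun p : ℝ × EuclideanSpace ℝ (Fin n) =>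
      k p.2 * dirDeriv p.2 f (x + p.1 • p.2) := by
    have h1 : Continuous (fderiv ℝ f) := hf.continuous_fderiv (by simp)
    unfold dirDeriv
    fun_prop
  obtain ⟨K, hK⟩ := ((isCompact_closedBall r 1).prod hkc.isCompact).exists_bound_of_continuousOn
    hdc.continuousOn
  have hfc := hf.continuous
  refine (hasDerivAt_integral_of_dominated_loc_of_deriv_le (F := fun r y => k y * f (x + r • y))
    (F' := fun r y => k y * dirDeriv y f (x + r • y)) (s := ball r 1)
    (bound := (tsupport k).indicator fun _ => K) (ball_mem_nhds r one_pos) ?_ ?_ ?_ ?_ ?_ ?_).2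
  · exact Filter.Eventually.of_forall fun s => by fun_prop
  · exact integrable_mul_of_hasCompactSupport hk hkc (by fun_prop)
  · exact (hdc.comp (Continuous.prodMk_right r)).aestronglyMeasurable
  · refine Filter.Eventually.of_forall fun y s hs => ?_
    by_cases hy : y ∈ tsupport k
    · rw [Set.indicator_of_mem hy]
      exact hK (s, y) ⟨ball_subset_closedBall hs, hy⟩
    · rw [Set.indicator_of_notMem hy, image_eq_zero_of_notMem_tsupport hy]
      simp
  · exact (integrable_indicator_iff (isClosed_tsupport k).measurableSet).2
      (integrableOn_const hkc.isCompact.measure_lt_top.ne)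
  · exact Filter.Eventually.of_forall fun y s _ => (hasDerivAt_comp_add_smul hf x y s).const_mul _

theorem integral_mul_dirDeriv {k h : EuclideanSpace ℝ (Fin n) → ℝ}
    (hk : ContDiff ℝ (⊤ : ℕ∞) k) (hkc : HasCompactSupport k) (hh : ContDiff ℝ (⊤ : ℕ∞) h)
    (e : EuclideanSpace ℝ (Fin n)) :
    ∫ y, k y * dirDeriv e h y = -∫ y, dirDeriv e k y * h y :=
  integral_mul_fderiv_eq_neg_fderiv_mul_of_integrable
    (integrable_mul_of_hasCompactSupport (hk.dirDeriv e).continuous (hkc.dirDeriv e) hh.continuous)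
    (integrable_mul_of_hasCompactSupport hk.continuous hkc (hh.dirDeriv e).continuous)
    (integrable_mul_of_hasCompactSupport hk.continuous hkc hh.continuous)
    (fun x _ => hk.differentiable_of_smooth x) (fun x _ => hh.differentiable_of_smooth x)

theorem ContDiff.comp_add_smul {f : EuclideanSpace ℝ (Fin n) → ℝ} (hf : ContDiff ℝ (⊤ : ℕ∞) f)
    (x : EuclideanSpace ℝ (Fin n)) (r : ℝ) : ContDiff ℝ (⊤ : ℕ∞) fun y => f (x + r • y) :=
  hf.comp (contDiff_const.add (contDiff_id.const_smul r))

theorem integral_mul_dirDeriv_comp {k f : EuclideanSpace ℝ (Fin n) → ℝ}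
    (hk : ContDiff ℝ (⊤ : ℕ∞) k) (hkc : HasCompactSupport k) (hf : ContDiff ℝ (⊤ : ℕ∞) f)
    (e x : EuclideanSpace ℝ (Fin n)) (r : ℝ) :
    r * ∫ y, k y * dirDeriv e f (x + r • y) = -∫ y, dirDeriv e k y * f (x + r • y) := by
  rw [← integral_mul_dirDeriv hk hkc (hf.comp_add_smul x r), ← integral_const_mul]
  refine integral_congr_ae (Filter.Eventually.of_forall fun y => ?_)
  simp only [dirDeriv_comp_add_smul hf]
  ring

theorem integral_mul_iterDirDeriv_comp {k f : EuclideanSpace ℝ (Fin n) → ℝ}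
    (hk : ContDiff ℝ (⊤ : ℕ∞) k) (hkc : HasCompactSupport k) (hf : ContDiff ℝ (⊤ : ℕ∞) f)
    (L : List (EuclideanSpace ℝ (Fin n))) (x : EuclideanSpace ℝ (Fin n)) (r : ℝ) :
    r ^ L.length * ∫ y, k y * iterDirDeriv L f (x + r • y) =
      (-1) ^ L.length * ∫ y, iterDirDeriv L.reverse k y * f (x + r • y) := by
  induction L generalizing k with
  | nil => simp [iterDirDeriv]
  | cons e L ih =>
    have h1 : iterDirDeriv (e :: L).reverse k = iterDirDeriv L.reverse (dirDeriv e k) := by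
      simp [iterDirDeriv]
    have h2 := integral_mul_dirDeriv_comp hk hkc (hf.iterDirDeriv L) e x r
    have h3 := ih (hk.dirDeriv e) (hkc.dirDeriv e)
    change r ^ (L.length + 1) * ∫ y, k y * dirDeriv e (iterDirDeriv L f) (x + r • y) =
      (-1) ^ (L.length + 1) * _
    rw [h1, pow_succ, mul_assoc, h2, pow_succ, mul_assoc, mul_neg, h3]
    ring

end Kernels

theorem exists_eq_sum_even_pow_of_hasDerivAt {F : ℝ → ℝ} (m : ℕ) (b : ℕ → ℝ)
    (hF : ∀ r, HasDerivAt F (r * ∑ k ∈ Finset.range m, b k * r ^ (2 * k)) r) :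
    ∃ a : ℕ → ℝ, ∀ r, F r = ∑ k ∈ Finset.range (m + 1), a k * r ^ (2 * k) := by
  have hP (r : ℝ) : HasDerivAt
      (fun r : ℝ => ∑ k ∈ Finset.range m, b k / (2 * k + 2 : ℝ) * r ^ (2 * (k + 1)))
      (r * ∑ k ∈ Finset.range m, b k * r ^ (2 * k)) r := by
    rw [Finset.mul_sum]
    refine HasDerivAt.fun_sum fun k _ => ?_
    refine ((hasDerivAt_pow (2 * (k + 1)) r).const_mul (b k / (2 * k + 2 : ℝ))).congr_deriv ?_
    have : (2 * k + 2 : ℝ) ≠ 0 := by positivity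
    rw [show 2 * (k + 1) - 1 = 2 * k + 1 by lia, pow_succ]
    push_cast
    field_simp
  have hc (r : ℝ) := is_const_of_deriv_eq_zero
    (fun r => ((hF r).sub (hP r)).differentiableAt)
    (fun r => by simpa using ((hF r).sub (hP r)).deriv) r 0
  refine ⟨fun k => k.casesOn (F 0) fun k => b k / (2 * k + 2 : ℝ), fun r => ?_⟩
  rw [Finset.sum_range_succ']
  have := hc r
  simp at this ⊢
  linarith

/-- A smooth radial profile: `g (‖y‖ ^ 2)` is smooth and vanishes off the unit ball. -/
structure IsRadialProfile (g : ℝ → ℝ) : Prop where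
  contDiff : ContDiff ℝ (⊤ : ℕ∞) g
  eq_zero : ∀ s, 1 ≤ s → g s = 0

/-- The radial profile `G` with `G' = -g / 2`, vanishing on `[1, ∞)`. -/
noncomputable def tailPrimitive (g : ℝ → ℝ) (s : ℝ) : ℝ :=
  -(1 / 2) * ∫ t in (1 : ℝ)..s, g t

namespace IsRadialProfile

variable {n : ℕ} {g : ℝ → ℝ}

theorem hasDerivAt_tailPrimitive (hg : IsRadialProfile g) (s : ℝ) :
    HasDerivAt (tailPrimitive g) (-(1 / 2) * g s) s :=
  (intervalIntegral.integral_hasDerivAt_right (hg.contDiff.continuous.intervalIntegrable 1 s)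
    (hg.contDiff.continuous.stronglyMeasurableAtFilter volume _)
    hg.contDiff.continuous.continuousAt).const_mul _

theorem tailPrimitive (hg : IsRadialProfile g) : IsRadialProfile (tailPrimitive g) where
  contDiff := by
    rw [contDiff_infty_iff_deriv]
    refine ⟨fun s => (hg.hasDerivAt_tailPrimitive s).differentiableAt, ?_⟩
    rw [funext fun s => (hg.hasDerivAt_tailPrimitive s).deriv]
    exact contDiff_const.mul hg.contDiff
  eq_zero s hs := by
    have : ∫ t in (1 : ℝ)..s, g t = ∫ t in (1 : ℝ)..s, (0 : ℝ) :=
      intervalIntegral.integral_congr fun t ht => by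
        rw [Set.uIcc_of_le hs] at ht
        exact hg.eq_zero t ht.1
    simp [_root_.tailPrimitive, this]

theorem contDiff_kernel (hg : IsRadialProfile g) :
    ContDiff ℝ (⊤ : ℕ∞) fun y : EuclideanSpace ℝ (Fin n) => g (‖y‖ ^ 2) :=
  hg.contDiff.comp (contDiff_norm_sq ℝ)

theorem kernel_eq_zero (hg : IsRadialProfile g) {y : EuclideanSpace ℝ (Fin n)}
    (hy : y ∉ ball (0 : EuclideanSpace ℝ (Fin n)) 1) : g (‖y‖ ^ 2) = 0 := by
  refine hg.eq_zero _ (one_le_pow₀ ?_)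
  simpa using hy

theorem tsupport_kernel_subset (hg : IsRadialProfile g) :
    tsupport (fun y : EuclideanSpace ℝ (Fin n) => g (‖y‖ ^ 2)) ⊆ closedBall 0 1 := by
  refine closure_minimal (fun y hy => ?_) isClosed_closedBall
  by_contra h
  exact hy (hg.kernel_eq_zero fun h' => h (ball_subset_closedBall h'))

theorem hasCompactSupport_kernel (hg : IsRadialProfile g) :
    HasCompactSupport fun y : EuclideanSpace ℝ (Fin n) => g (‖y‖ ^ 2) :=
  (isCompact_closedBall _ _).of_isClosed_subset (isClosed_tsupport _) hg.tsupport_kernel_subset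

theorem dirDeriv_tailPrimitive_kernel (hg : IsRadialProfile g) (e y : EuclideanSpace ℝ (Fin n)) :
    dirDeriv e (fun y => _root_.tailPrimitive g (‖y‖ ^ 2)) y = -(inner ℝ y e * g (‖y‖ ^ 2)) := by
  have h := (hg.hasDerivAt_tailPrimitive (‖y‖ ^ 2)).comp_hasFDerivAt y
    (hasStrictFDerivAt_norm_sq y).hasFDerivAt
  change fderiv ℝ (_root_.tailPrimitive g ∘ fun y => ‖y‖ ^ 2) y e = _
  rw [h.fderiv]
  simp
  ring

theorem hasDerivAt_integral (hg : IsRadialProfile g) {f : EuclideanSpace ℝ (Fin n) → ℝ}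
    (hf : ContDiff ℝ (⊤ : ℕ∞) f) (x : EuclideanSpace ℝ (Fin n)) (r : ℝ) :
    HasDerivAt (fun r : ℝ => ∫ y, g (‖y‖ ^ 2) * f (x + r • y))
      (r * ∫ y, _root_.tailPrimitive g (‖y‖ ^ 2) * lap f (x + r • y)) r := by
  convert hasDerivAt_integral_kernel hg.contDiff_kernel.continuous hg.hasCompactSupport_kernel
    hf x r using 1
  have hG := hg.tailPrimitive
  have hdir (y : EuclideanSpace ℝ (Fin n)) : dirDeriv y f (x + r • y) =
      ∑ i, y i * dirDeriv (EuclideanSpace.single i 1) f (x + r • y) := by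
    have hy : y = ∑ i, y i • EuclideanSpace.single i (1 : ℝ) := by
      ext j
      simp [Pi.single_apply]
    unfold dirDeriv
    generalize fderiv ℝ f (x + r • y) = T
    conv_lhs => rw [hy]
    simp
  simp only [hdir, lap_eq_sum_dirDeriv hf, Finset.mul_sum]
  have hint1 (i : Fin n) : Integrable fun y : EuclideanSpace ℝ (Fin n) =>
      _root_.tailPrimitive g (‖y‖ ^ 2) * dirDeriv (EuclideanSpace.single i 1)
        (dirDeriv (EuclideanSpace.single i 1) f) (x + r • y) :=
    integrable_mul_of_hasCompactSupport hG.contDiff_kernel.continuous hG.hasCompactSupport_kernel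
      (((hf.dirDeriv _).dirDeriv _).comp_add_smul x r).continuous
  have hint2 (i : Fin n) : Integrable fun y : EuclideanSpace ℝ (Fin n) =>
      g (‖y‖ ^ 2) * (y i * dirDeriv (EuclideanSpace.single i 1) f (x + r • y)) := by
    refine integrable_mul_of_hasCompactSupport hg.contDiff_kernel.continuous
      hg.hasCompactSupport_kernel ?_
    have := ((hf.dirDeriv (EuclideanSpace.single i 1)).comp_add_smul x r).continuous
    fun_prop
  rw [integral_finsetSum _ fun i _ => hint1 i, integral_finsetSum _ fun i _ => hint2 i,
    Finset.mul_sum]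
  refine Finset.sum_congr rfl fun i _ => ?_
  rw [integral_mul_dirDeriv_comp hG.contDiff_kernel hG.hasCompactSupport_kernel (hf.dirDeriv _),
    ← integral_neg]
  refine integral_congr_ae (Filter.Eventually.of_forall fun y => ?_)
  simp only [hg.dirDeriv_tailPrimitive_kernel, EuclideanSpace.inner_single_right, conj_trivial]
  ring

/-- **Pizzetti's formula**, qualitatively: radial averages of a polyharmonic function are even
polynomials in the radius. -/
theorem exists_integral_eq_sum_even_pow (hg : IsRadialProfile g) (m : ℕ)
    {f : EuclideanSpace ℝ (Fin n) → ℝ} (hf : ContDiff ℝ (⊤ : ℕ∞) f) (h : lapIter (m + 1) f = 0)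
    (x : EuclideanSpace ℝ (Fin n)) :
    ∃ a : ℕ → ℝ, ∀ r : ℝ, ∫ y, g (‖y‖ ^ 2) * f (x + r • y) =
      ∑ k ∈ Finset.range (m + 1), a k * r ^ (2 * k) := by
  induction m generalizing f g with
  | zero =>
    have h0 : lap f = 0 := h
    exact exists_eq_sum_even_pow_of_hasDerivAt 0 0
      fun r => by simpa [h0] using hg.hasDerivAt_integral hf x r
  | succ m ih =>
    obtain ⟨b, hb⟩ := ih hg.tailPrimitive hf.lap h
    exact exists_eq_sum_even_pow_of_hasDerivAt (m + 1) b
      fun r => hb r ▸ hg.hasDerivAt_integral hf x r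

end IsRadialProfile
theorem exists_extrapolation_coeff (N : ℕ) :
    ∃ c : ℕ → ℝ, ∀ P : Polynomial ℝ, P.natDegree < N →
      P.eval 0 = ∑ j ∈ Finset.range N, c j * P.eval (j + 1 : ℝ) := by
  refine ⟨fun j => -((-1) ^ N * ((-1) ^ (N - (j + 1)) * N.choose (j + 1))), fun P hP => ?_⟩
  have h := congrFun (Polynomial.fwdDiff_iter_eq_zero_of_degree_lt hP) 0
  rw [fwdDiff_iter_eq_sum_shift, Finset.sum_range_succ'] at h
  have hs : (-1 : ℝ) ^ N * (-1) ^ N = 1 := by rw [← mul_pow]; simp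
  have h' : ∑ j ∈ Finset.range N, (-1) ^ (N - (j + 1)) * (N.choose (j + 1) : ℝ) *
      P.eval (j + 1 : ℝ) + (-1) ^ N * P.eval 0 = 0 := by
    simpa using h
  simp only [neg_mul, Finset.sum_neg_distrib, mul_assoc, ← Finset.mul_sum] at h' ⊢
  linear_combination (-1 : ℝ) ^ N * h' - P.eval 0 * hs

theorem exists_extrapolation_coeff_even (m : ℕ) :
    ∃ c : ℕ → ℝ, ∀ a : ℕ → ℝ, ∀ F : ℝ → ℝ,
      (∀ r, F r = ∑ k ∈ Finset.range (m + 1), a k * r ^ (2 * k)) → ∀ R : ℝ,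
      F 0 = ∑ j ∈ Finset.range (2 * m + 1), c j * F ((j + 1) * R) := by
  obtain ⟨c, hc⟩ := exists_extrapolation_coeff (2 * m + 1)
  refine ⟨c, fun a F hF R => ?_⟩
  let P : Polynomial ℝ := ∑ k ∈ Finset.range (m + 1),
    Polynomial.C (a k * R ^ (2 * k)) * Polynomial.X ^ (2 * k)
  have hP (r : ℝ) : P.eval r = F (r * R) := by
    simp only [P, hF, Polynomial.eval_finsetSum]
    refine Finset.sum_congr rfl fun k _ => ?_
    simp [mul_pow]
    ring
  have hdeg : P.natDegree < 2 * m + 1 := by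
    refine Nat.lt_succ_of_le (Polynomial.natDegree_sum_le_of_forall_le _ _ fun k hk => ?_)
    refine (Polynomial.natDegree_C_mul_X_pow_le _ _).trans ?_
    have := Finset.mem_range.1 hk
    lia
  simpa [hP] using hc P hdeg

/-- A smooth cut-off profile, equal to `1` on `(-∞, 1/2]` and to `0` on `[1, ∞)`. -/
noncomputable def cutoffProfile (s : ℝ) : ℝ :=
  smoothTransition (2 - 2 * s)

theorem isRadialProfile_cutoffProfile : IsRadialProfile cutoffProfile where
  contDiff := smoothTransition.contDiff.comp (contDiff_const.sub (contDiff_const.mul contDiff_id))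
  eq_zero s hs := smoothTransition.zero_of_nonpos (by linarith)

theorem isRadialProfile_cutoffProfile_two_mul : IsRadialProfile fun s => cutoffProfile (2 * s) where
  contDiff := isRadialProfile_cutoffProfile.contDiff.comp (contDiff_const.mul contDiff_id)
  eq_zero s hs := isRadialProfile_cutoffProfile.eq_zero _ (by linarith)

section Growth

variable {n : ℕ}

theorem tsupport_cutoffProfile_two_mul_subset :
    tsupport (fun y : EuclideanSpace ℝ (Fin n) => cutoffProfile (2 * ‖y‖ ^ 2)) ⊆
      {y | ‖y‖ ^ 2 ≤ 1 / 2} := by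
  refine closure_minimal (fun y hy => ?_) (isClosed_le (by fun_prop) continuous_const)
  by_contra h
  refine hy (isRadialProfile_cutoffProfile.eq_zero _ ?_)
  simp only [Set.mem_ofPred_eq, not_le] at h
  linarith

theorem integral_cutoffProfile_pos :
    0 < ∫ y : EuclideanSpace ℝ (Fin n), cutoffProfile (2 * ‖y‖ ^ 2) := by
  have hk := isRadialProfile_cutoffProfile_two_mul
  refine hk.contDiff_kernel.continuous.integral_pos_of_hasCompactSupport_nonneg_nonzero
    hk.hasCompactSupport_kernel (fun y => smoothTransition.nonneg _) (x := 0) ?_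
  simp [cutoffProfile]

theorem exists_abs_iterDirDeriv_cutoff_le (L : List (EuclideanSpace ℝ (Fin n))) :
    ∃ M : ℝ, 0 ≤ M ∧ ∀ y : EuclideanSpace ℝ (Fin n),
      |iterDirDeriv L (fun y => cutoffProfile (2 * ‖y‖ ^ 2)) y| ≤ M * cutoffProfile (‖y‖ ^ 2) := by
  have hk := isRadialProfile_cutoffProfile_two_mul
  obtain ⟨M, hM⟩ := ((hk.hasCompactSupport_kernel (n := n)).iterDirDeriv
    L).exists_bound_of_continuous (hk.contDiff_kernel.iterDirDeriv L).continuous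
  have hM0 : 0 ≤ M := (norm_nonneg _).trans (hM 0)
  refine ⟨M, hM0, fun y => ?_⟩
  by_cases hy : y ∈ tsupport (iterDirDeriv L
      fun y : EuclideanSpace ℝ (Fin n) => cutoffProfile (2 * ‖y‖ ^ 2))
  · have hy' : ‖y‖ ^ 2 ≤ 1 / 2 :=
      tsupport_cutoffProfile_two_mul_subset (tsupport_iterDirDeriv_subset _ L hy)
    rw [cutoffProfile, smoothTransition.one_of_one_le (by linarith), mul_one]
    exact hM y
  · rw [image_eq_zero_of_notMem_tsupport hy, abs_zero]
    exact mul_nonneg hM0 (smoothTransition.nonneg _)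

theorem integral_indicator_ball_comp_add_smul (f : EuclideanSpace ℝ (Fin n) → ℝ)
    (x : EuclideanSpace ℝ (Fin n)) {r : ℝ} (hr : 0 < r) :
    ∫ y, (ball (0 : EuclideanSpace ℝ (Fin n)) 1).indicator (fun y => f (x + r • y)) y =
      volume.real (ball (0 : EuclideanSpace ℝ (Fin n)) 1) * ⨍ y in ball x r, f y := by
  have h1 : (ball (0 : EuclideanSpace ℝ (Fin n)) 1).indicator (fun y => f (x + r • y)) =
      fun y => (fun z => (ball x r).indicator f (x + z)) (r • y) := by
    ext y
    have : y ∈ ball (0 : EuclideanSpace ℝ (Fin n)) 1 ↔ x + r • y ∈ ball x r := by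
      simp [norm_smul, abs_of_pos hr, hr]
    by_cases hy : y ∈ ball (0 : EuclideanSpace ℝ (Fin n)) 1
    · simp only [Set.indicator_of_mem hy, Set.indicator_of_mem (this.1 hy)]
    · simp only [Set.indicator_of_notMem hy, Set.indicator_of_notMem fun h => hy (this.2 h)]
  have hball : volume.real (ball x r) =
      r ^ n * volume.real (ball (0 : EuclideanSpace ℝ (Fin n)) 1) := by
    rw [measureReal_def, measureReal_def, Measure.addHaar_ball_of_pos volume x hr, ENNReal.toReal_mul,
      ENNReal.toReal_ofReal (by positivity), finrank_euclideanSpace_fin]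
  have hpos : 0 < volume.real (ball (0 : EuclideanSpace ℝ (Fin n)) 1) :=
    ENNReal.toReal_pos (measure_ball_pos volume _ one_pos).ne' measure_ball_lt_top.ne
  rw [h1, Measure.integral_comp_smul, integral_add_left_eq_self,
    integral_indicator measurableSet_ball, setAverage_eq, hball, finrank_euclideanSpace_fin,
    abs_of_pos (by positivity), smul_eq_mul, smul_eq_mul]
  field_simp

theorem integral_cutoff_mul_le (f : EuclideanSpace ℝ (Fin n) → ℝ) (hf : Continuous f)
    (hf0 : ∀ x, 0 ≤ f x) (x : EuclideanSpace ℝ (Fin n)) {r : ℝ} (hr : 0 < r) :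
    ∫ y, cutoffProfile (‖y‖ ^ 2) * f (x + r • y) ≤
      volume.real (ball (0 : EuclideanSpace ℝ (Fin n)) 1) * ⨍ y in ball x r, f y := by
  rw [← integral_indicator_ball_comp_add_smul f x hr]
  have hk := isRadialProfile_cutoffProfile
  have hfc : Continuous fun y => f (x + r • y) := by fun_prop
  refine integral_mono (integrable_mul_of_hasCompactSupport hk.contDiff_kernel.continuous
    hk.hasCompactSupport_kernel hfc) ?_ fun y => ?_
  · rw [integrable_indicator_iff measurableSet_ball]
    exact (hfc.continuousOn.integrableOn_compact (isCompact_closedBall _ _)).mono_set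
      ball_subset_closedBall
  · by_cases hy : y ∈ ball (0 : EuclideanSpace ℝ (Fin n)) 1
    · rw [Set.indicator_of_mem hy]
      exact mul_le_of_le_one_left (hf0 _) (smoothTransition.le_one _)
    · simp only [Set.indicator_of_notMem hy, hk.kernel_eq_zero hy, zero_mul, le_refl]

theorem abs_sum_even_pow_le (m : ℕ) (a : ℕ → ℝ) {r : ℝ} (hr : 1 ≤ r) :
    |∑ k ∈ Finset.range (m + 1), a k * r ^ (2 * k)| ≤
      (∑ k ∈ Finset.range (m + 1), |a k|) * r ^ (2 * m) := by
  rw [Finset.sum_mul]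
  refine (Finset.abs_sum_le_sum_abs _ _).trans (Finset.sum_le_sum fun k hk => ?_)
  rw [abs_mul, abs_of_nonneg (by positivity : 0 ≤ r ^ (2 * k))]
  gcongr
  · exact Nat.lt_succ_iff.1 (Finset.mem_range.1 hk)

/-- A logarithmic bound on the averages of `v⁺` controls the averages of `|v|`, by Pizzetti's
formula. -/
theorem exists_integral_cutoff_mul_abs_le {m : ℕ} (hm : 1 ≤ m)
    {v : EuclideanSpace ℝ (Fin n) → ℝ} (hv : ContDiff ℝ (⊤ : ℕ∞) v) (h : lapIter (m + 1) v = 0)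
    {C : ℝ} {x : EuclideanSpace ℝ (Fin n)} {R₀ : ℝ}
    (havg : ∀ R : ℝ, R₀ ≤ R → (⨍ y in ball x R, max (v y) 0) ≤ C * Real.log (2 * R + 2)) :
    ∃ K : ℝ, ∀ r : ℝ, max R₀ 1 ≤ r →
      ∫ y, cutoffProfile (‖y‖ ^ 2) * |v (x + r • y)| ≤ K * r ^ (2 * m) := by
  have hk := isRadialProfile_cutoffProfile
  obtain ⟨a, ha⟩ := hk.exists_integral_eq_sum_even_pow m hv h x
  set V := volume.real (ball (0 : EuclideanSpace ℝ (Fin n)) 1)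
  refine ⟨2 * (V * (|C| * 3)) + ∑ k ∈ Finset.range (m + 1), |a k|, fun r hr => ?_⟩
  have hr1 : 1 ≤ r := (le_max_right _ _).trans hr
  have hvc := hv.continuous
  have hposc : Continuous fun y => max (v y) 0 := by fun_prop
  have hint1 : Integrable fun y => cutoffProfile (‖y‖ ^ 2) * max (v (x + r • y)) 0 :=
    integrable_mul_of_hasCompactSupport hk.contDiff_kernel.continuous hk.hasCompactSupport_kernel
      (by fun_prop)
  have hint2 : Integrable fun y => cutoffProfile (‖y‖ ^ 2) * v (x + r • y) :=
    integrable_mul_of_hasCompactSupport hk.contDiff_kernel.continuous hk.hasCompactSupport_kernel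
      (by fun_prop)
  have hsplit : ∫ y, cutoffProfile (‖y‖ ^ 2) * |v (x + r • y)| =
      2 * (∫ y, cutoffProfile (‖y‖ ^ 2) * max (v (x + r • y)) 0) -
        ∫ y, cutoffProfile (‖y‖ ^ 2) * v (x + r • y) := by
    rw [← integral_const_mul, ← integral_sub (hint1.const_mul 2) hint2]
    refine integral_congr_ae (Filter.Eventually.of_forall fun y => ?_)
    rcases le_total (v (x + r • y)) 0 with h0 | h0
    · simp [abs_of_nonpos h0, max_eq_right h0]
    · simp only [abs_of_nonneg h0, max_eq_left h0]
      ring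
  have hlog : C * Real.log (2 * r + 2) ≤ |C| * 3 * r ^ (2 * m) := by
    have h1 : Real.log (2 * r + 2) ≤ 3 * r :=
      (Real.log_le_sub_one_of_pos (by linarith)).trans (by linarith)
    have h2 : 0 ≤ Real.log (2 * r + 2) := Real.log_nonneg (by linarith)
    have h3 : r ≤ r ^ (2 * m) := le_self_pow₀ hr1 (by lia)
    calc C * Real.log (2 * r + 2) ≤ |C| * Real.log (2 * r + 2) := by
          gcongr
          exact le_abs_self C
      _ ≤ |C| * (3 * r ^ (2 * m)) := by
          gcongr
          linarith
      _ = _ := by ring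
  have hpos := integral_cutoff_mul_le (fun y => max (v y) 0) hposc (fun _ => le_max_right _ _) x
    (zero_lt_one.trans_le hr1)
  have hbound : V * (⨍ y in ball x r, max (v y) 0) ≤ V * (|C| * 3 * r ^ (2 * m)) := by
    gcongr
    exact (havg r ((le_max_left _ _).trans hr)).trans hlog
  have hpoly := (neg_le_abs _).trans (abs_sum_even_pow_le m a hr1)
  rw [hsplit, ha]
  linarith

theorem abs_integral_iterDirDeriv_cutoff_mul_le {L : List (EuclideanSpace ℝ (Fin n))} {M : ℝ}
    (hM : ∀ y : EuclideanSpace ℝ (Fin n),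
      |iterDirDeriv L (fun y => cutoffProfile (2 * ‖y‖ ^ 2)) y| ≤ M * cutoffProfile (‖y‖ ^ 2))
    {f : EuclideanSpace ℝ (Fin n) → ℝ} (hf : Continuous f) :
    |∫ y, iterDirDeriv L (fun y => cutoffProfile (2 * ‖y‖ ^ 2)) y * f y| ≤
      M * ∫ y, cutoffProfile (‖y‖ ^ 2) * |f y| := by
  have hk := isRadialProfile_cutoffProfile
  rw [← integral_const_mul, ← Real.norm_eq_abs]
  have hint : Integrable fun y : EuclideanSpace ℝ (Fin n) => cutoffProfile (‖y‖ ^ 2) * |f y| :=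
    integrable_mul_of_hasCompactSupport hk.contDiff_kernel.continuous hk.hasCompactSupport_kernel
      hf.abs
  refine norm_integral_le_of_norm_le (hint.const_mul M)
    (Filter.Eventually.of_forall fun y => ?_)
  rw [Real.norm_eq_abs, abs_mul, ← mul_assoc]
  exact mul_le_mul_of_nonneg_right (hM y) (abs_nonneg _)

theorem iterDirDeriv_eq_zero_of_log_growth {m : ℕ} (hm : 1 ≤ m)
    {v : EuclideanSpace ℝ (Fin n) → ℝ} (hv : ContDiff ℝ (⊤ : ℕ∞) v) (h : lapIter (m + 1) v = 0)
    {C : ℝ} {x : EuclideanSpace ℝ (Fin n)} {R₀ : ℝ}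
    (havg : ∀ R : ℝ, R₀ ≤ R → (⨍ y in ball x R, max (v y) 0) ≤ C * Real.log (2 * R + 2))
    {L : List (EuclideanSpace ℝ (Fin n))} (hL : L.length = 2 * m + 1) :
    iterDirDeriv L v x = 0 := by
  obtain ⟨K, hK⟩ := exists_integral_cutoff_mul_abs_le hm hv h havg
  obtain ⟨M, hM0, hM⟩ := exists_abs_iterDirDeriv_cutoff_le L.reverse
  obtain ⟨c, hc⟩ := exists_extrapolation_coeff_even m
  have hk := isRadialProfile_cutoffProfile_two_mul
  have hkc := hk.contDiff_kernel (n := n)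
  have hks := hk.hasCompactSupport_kernel (n := n)
  set k : EuclideanSpace ℝ (Fin n) → ℝ := fun y => cutoffProfile (2 * ‖y‖ ^ 2) with hkdef
  have hkpos : 0 < ∫ y, k y := integral_cutoffProfile_pos
  have hw := hv.iterDirDeriv L
  obtain ⟨a, ha⟩ := hk.exists_integral_eq_sum_even_pow m hw
    (lapIter_iterDirDeriv_eq_zero hv h L) x
  have hmean : ∀ R : ℝ, (∫ y, k y) * iterDirDeriv L v x = ∑ j ∈ Finset.range (2 * m + 1),
      c j * ∫ y, k y * iterDirDeriv L v (x + ((j + 1) * R) • y) := by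
    intro R
    have := hc a _ ha R
    simpa [integral_mul_const, hkdef] using this
  have hterm : ∀ r : ℝ, max R₀ 1 ≤ r →
      |∫ y, k y * iterDirDeriv L v (x + r • y)| ≤ M * K / r := by
    intro r hr
    have hr0 : 0 < r := zero_lt_one.trans_le ((le_max_right _ _).trans hr)
    have h1 := congrArg abs (integral_mul_iterDirDeriv_comp hkc hks hv L x r)
    rw [abs_mul, abs_mul, abs_pow, abs_pow, abs_neg, abs_one, one_pow, one_mul, abs_of_pos hr0,
      hL] at h1
    have h2 := abs_integral_iterDirDeriv_cutoff_mul_le hM (hv.comp_add_smul x r).continuous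
    have h3 := mul_le_mul_of_nonneg_left (hK r hr) hM0
    rw [le_div_iff₀ hr0]
    refine le_of_mul_le_mul_left ?_ (pow_pos hr0 (2 * m))
    calc r ^ (2 * m) * (|∫ y, k y * iterDirDeriv L v (x + r • y)| * r)
        = r ^ (2 * m + 1) * |∫ y, k y * iterDirDeriv L v (x + r • y)| := by ring
      _ ≤ M * (K * r ^ (2 * m)) := h1.trans_le (h2.trans h3)
      _ = _ := by ring
  have hbound : ∀ R : ℝ, max R₀ 1 ≤ R → |(∫ y, k y) * iterDirDeriv L v x| ≤
      (∑ j ∈ Finset.range (2 * m + 1), |c j| * (M * |K|)) / R := by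
    intro R hR
    have hR0 : 0 < R := zero_lt_one.trans_le ((le_max_right _ _).trans hR)
    rw [hmean R, Finset.sum_div]
    refine (Finset.abs_sum_le_sum_abs _ _).trans (Finset.sum_le_sum fun j _ => ?_)
    have hjR : R ≤ (j + 1) * R := le_mul_of_one_le_left hR0.le (by simp)
    rw [abs_mul, mul_div_assoc]
    gcongr
    refine (hterm _ (hR.trans hjR)).trans ?_
    gcongr
    exact le_abs_self K
  have hlim := Filter.Tendsto.const_div_atTop Filter.tendsto_id
    (∑ j ∈ Finset.range (2 * m + 1), |c j| * (M * |K|))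
  have hle := ge_of_tendsto hlim ((Filter.eventually_ge_atTop (max R₀ 1)).mono hbound)
  have h0 := abs_nonpos_iff.1 hle
  exact (mul_eq_zero.1 h0).resolve_left hkpos.ne'

end Growth

section Taylor

variable {n : ℕ}

theorem iteratedDeriv_comp_smul {f : EuclideanSpace ℝ (Fin n) → ℝ} (hf : ContDiff ℝ (⊤ : ℕ∞) f)
    (x : EuclideanSpace ℝ (Fin n)) (k : ℕ) :
    iteratedDeriv k (fun t : ℝ => f (t • x)) = fun t => iteratedFDeriv ℝ k f (t • x) fun _ => x := by
  have h (t : ℝ) : (iteratedFDeriv ℝ k f (t • x) fun _ => x) =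
      iterDirDeriv (List.replicate k x) f (t • x) := by
    rw [iteratedFDeriv_apply_eq_iterDirDeriv hf, List.ofFn_const]
  simp only [h]
  clear h
  induction k with
  | zero => rfl
  | succ k ih =>
    ext t
    rw [iteratedDeriv_succ, ih]
    have := (hasDerivAt_comp_add_smul (hf.iterDirDeriv (List.replicate k x)) 0 x t).deriv
    simp only [zero_add] at this
    exact this

theorem exists_mvPolynomial_eq_multilinear {k : ℕ}
    (T : EuclideanSpace ℝ (Fin n) [×k]→L[ℝ] ℝ) :
    ∃ p : MvPolynomial (Fin n) ℝ, (∀ x, (T fun _ => x) = evalPoly p x) ∧ p.totalDegree ≤ k := by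
  refine ⟨∑ s : Fin k → Fin n, MvPolynomial.C (T fun i => EuclideanSpace.single (s i) 1) *
    ∏ i, MvPolynomial.X (s i), fun x => ?_, ?_⟩
  · have hx : x = ∑ i, x i • EuclideanSpace.single i (1 : ℝ) := by
      ext j
      simp [Pi.single_apply]
    have h := T.toMultilinearMap.map_sum
      (g := fun (_ : Fin k) (j : Fin n) => x j • EuclideanSpace.single j (1 : ℝ))
    rw [← hx] at h
    refine h.trans ?_
    simp only [evalPoly, map_sum, map_mul, map_prod, eval_C, eval_X]
    refine Finset.sum_congr rfl fun s _ => ?_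
    rw [T.toMultilinearMap.map_smul_univ, smul_eq_mul, mul_comm]
    rfl
  · refine MvPolynomial.totalDegree_finsetSum_le fun s _ => ?_
    refine (MvPolynomial.totalDegree_mul _ _).trans ?_
    rw [totalDegree_C, zero_add]
    refine (MvPolynomial.totalDegree_finsetProd _ _).trans ?_
    simp

theorem exists_mvPolynomial_of_iteratedFDeriv_eq_zero {f : EuclideanSpace ℝ (Fin n) → ℝ}
    (hf : ContDiff ℝ (⊤ : ℕ∞) f) (d : ℕ) (h : ∀ x, iteratedFDeriv ℝ (d + 1) f x = 0) :
    ∃ p : MvPolynomial (Fin n) ℝ, (∀ x, f x = evalPoly p x) ∧ p.totalDegree ≤ d := by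
  choose p hp hpd using fun k => exists_mvPolynomial_eq_multilinear (iteratedFDeriv ℝ k f 0)
  refine ⟨∑ k ∈ Finset.range (d + 1), MvPolynomial.C ((k.factorial : ℝ)⁻¹) * p k, fun x => ?_, ?_⟩
  · have hg : ContDiff ℝ (⊤ : ℕ∞) fun t : ℝ => f (t • x) :=
      hf.comp (contDiff_id.smul contDiff_const)
    obtain ⟨t, -, ht⟩ := taylor_mean_remainder_lagrange_iteratedDeriv (f := fun t : ℝ => f (t • x))
      (x := 1) (x₀ := 0) (n := d) (by norm_num) (hg.contDiffOn.of_le (by exact_mod_cast le_top))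
    rw [iteratedDeriv_comp_smul hf, taylor_within_apply] at ht
    simp only [h, iteratedDerivWithin_eq_iteratedDeriv (uniqueDiffOn_uIcc (zero_ne_one' ℝ))
      (hg.of_le (by exact_mod_cast le_top)).contDiffAt Set.left_mem_uIcc,
      iteratedDeriv_comp_smul hf] at ht
    simp [hp] at ht
    simp only [evalPoly, map_sum, map_mul, eval_C] at ht ⊢
    linarith
  · refine MvPolynomial.totalDegree_finsetSum_le fun k hk => ?_
    refine (MvPolynomial.totalDegree_mul _ _).trans ?_
    rw [totalDegree_C, zero_add]
    exact (hpd k).trans (Nat.lt_succ_iff.1 (Finset.mem_range.1 hk))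

end Taylor

/-- If `n ≥ 4` is even, `v` is smooth with `Δ^{n/2} v = 0` on `ℝⁿ`, and the ball averages
of `v⁺` satisfy `⨍_{B_R(x₀)} v⁺ ≤ C log(2R + 2)` for all sufficiently large `R`, then all
derivatives of `v` of order `n − 1` vanish identically; in particular `v` is a polynomial
of degree at most `n − 2`. -/
theorem polyharmonic_log_growth (n : ℕ) (hn4 : 4 ≤ n) (hne : Even n)
    (v : EuclideanSpace ℝ (Fin n) → ℝ) (hsmooth : ContDiff ℝ (⊤ : ℕ∞) v)
    (hpolyharm : ∀ x, lapIter (n / 2) v x = 0)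
    (C : ℝ)
    (havg : ∀ x₀ : EuclideanSpace ℝ (Fin n), ∃ R₀ : ℝ, ∀ R : ℝ, R₀ ≤ R →
      (⨍ y in ball x₀ R, max (v y) 0) ≤ C * Real.log (2 * R + 2)) :
    (∀ x : EuclideanSpace ℝ (Fin n), iteratedFDeriv ℝ (n - 1) v x = 0) ∧
    ∃ p : MvPolynomial (Fin n) ℝ,
      (∀ x, v x = evalPoly p x) ∧ p.totalDegree ≤ n - 2 := by
  obtain ⟨m, hm⟩ : ∃ m, n = 2 * m + 2 := by
    obtain ⟨k, hk⟩ := hne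
    exact ⟨k - 1, by lia⟩
  have hlap : lapIter (m + 1) v = 0 := by
    ext x
    rw [show m + 1 = n / 2 by lia]
    exact hpolyharm x
  have hzero (x : EuclideanSpace ℝ (Fin n)) : iteratedFDeriv ℝ (2 * m + 1) v x = 0 := by
    obtain ⟨R₀, hR₀⟩ := havg x
    ext e
    rw [iteratedFDeriv_apply_eq_iterDirDeriv hsmooth,
      iterDirDeriv_eq_zero_of_log_growth (by lia) hsmooth hlap hR₀ List.length_ofFn]
    rfl
  rw [show n - 1 = 2 * m + 1 by lia, show n - 2 = 2 * m by lia]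
  exact ⟨hzero, exists_mvPolynomial_of_iteratedFDeriv_eq_zero hsmooth _ hzero⟩
end
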